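/- Let Ω ⊆ ℂⁿ be a domain, let α ∈ (ℤ₊)ⁿ, and let f : Ω → ℂ be a function (no continuity or measurability assumed) such that for each j ∈ {1,…,n} and each choice of fixed values of the other coordinates, the one-variable function z_j ↦ f(z_1,…,z_n) is α_j-analytic on the corresponding open slice of Ω. Then f is C^∞-smooth in the underlying real coordinates (x,y) on Ω and is α-analytic on Ω. -/

import Mathlib

noncomputable section

/-- A function `g` is `q`-analytic (polyanalytic of order `q`) on `U ⊆ ℂ` if
`g(z) = ∑_{j<q} a_j(z) * (conj z)^j` for holomorphic functions `a_j` on `U`. -/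
def QAnalyticOn (q : ℕ) (g : ℂ → ℂ) (U : Set ℂ) : Prop :=
  ∃ a : Fin q → ℂ → ℂ, (∀ j, DifferentiableOn ℂ (a j) U) ∧
    ∀ z ∈ U, g z = ∑ j : Fin q, a j z * (starRingEnd ℂ z) ^ (j : ℕ)

/-- The Wirtinger derivative `∂/∂z̄_j = ½(∂/∂x_j + i ∂/∂y_j)` of `f : ℂⁿ → ℂ`. -/
def wirtingerBar (n : ℕ) (j : Fin n) (f : (Fin n → ℂ) → ℂ) : (Fin n → ℂ) → ℂ :=
  fun z => (1 / 2 : ℂ) *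
    (fderiv ℝ f z (Pi.single j 1) + Complex.I * fderiv ℝ f z (Pi.single j Complex.I))

/-- `f` is `α`-analytic (polyanalytic of order `α`) on `Ω ⊆ ℂⁿ`: it is smooth (in the
underlying real coordinates) and `(∂/∂z̄_j)^{α_j} f = 0` on `Ω` for each `j`. -/
def PolyanalyticOn (n : ℕ) (α : Fin n → ℕ) (f : (Fin n → ℂ) → ℂ)
    (Ω : Set (Fin n → ℂ)) : Prop :=
  ContDiffOn ℝ (⊤ : ℕ∞) f Ω ∧ ∀ j : Fin n, ∀ z ∈ Ω, ((wirtingerBar n j)^[α j] f) z = 0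

section

open MeasureTheory Metric Filter Topology
open scoped ENNReal NNReal ComplexConjugate

namespace QAnalyticOn

variable {q : ℕ} {g : ℂ → ℂ} {U V : Set ℂ}

theorem mono (hg : QAnalyticOn q g U) (hV : V ⊆ U) : QAnalyticOn q g V := by
  obtain ⟨a, ha, hs⟩ := hg
  exact ⟨a, fun j => (ha j).mono hV, fun z hz => hs z (hV hz)⟩

theorem const_mul (hg : QAnalyticOn q g U) (c : ℂ) : QAnalyticOn q (fun z => c * g z) U := by
  obtain ⟨a, ha, hs⟩ := hg
  refine ⟨fun j z => c * a j z, fun j => (ha j).const_mul c, fun z hz => ?_⟩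
  simp only [hs z hz, Finset.mul_sum, mul_assoc]

theorem sum {ι : Type*} (s : Finset ι) {G : ι → ℂ → ℂ} (hG : ∀ i ∈ s, QAnalyticOn q (G i) U) :
    QAnalyticOn q (fun z => ∑ i ∈ s, G i z) U := by
  choose! a ha hs using hG
  refine ⟨fun j z => ∑ i ∈ s, a i j z, fun j => DifferentiableOn.fun_sum fun i hi => ha i hi j,
    fun z hz => ?_⟩
  change ∑ i ∈ s, G i z = _
  rw [Finset.sum_congr rfl fun i hi => hs i hi z hz, Finset.sum_comm]
  simp only [Finset.sum_mul]

theorem continuousOn (hg : QAnalyticOn q g U) : ContinuousOn g U := by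
  obtain ⟨a, ha, hs⟩ := hg
  refine ContinuousOn.congr ?_ hs
  refine continuousOn_finsetSum _ fun j _ => (ha j).continuousOn.mul ?_
  exact (Complex.continuous_conj.pow _).continuousOn

/-- Recentring: the powers of `conj z` may be taken about any point. The top coefficient is not
affected. -/
theorem exists_translate {a : Fin (q + 1) → ℂ → ℂ} (ha : ∀ j, DifferentiableOn ℂ (a j) U)
    (hs : ∀ z ∈ U, g z = ∑ j, a j z * conj z ^ (j : ℕ)) (c : ℂ) :
    ∃ b : Fin (q + 1) → ℂ → ℂ, (∀ j, DifferentiableOn ℂ (b j) {t | c + t ∈ U}) ∧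
      (∀ t, c + t ∈ U → g (c + t) = ∑ j, b j t * conj t ^ (j : ℕ)) ∧
      ∀ t, b (Fin.last q) t = a (Fin.last q) (c + t) := by
  refine ⟨fun i t => ∑ j : Fin (q + 1), a j (c + t) *
    (((j : ℕ).choose i : ℂ) * conj c ^ ((j : ℕ) - i)), fun i => ?_, fun t ht => ?_, fun t => ?_⟩
  · refine DifferentiableOn.fun_sum fun j _ => DifferentiableOn.mul_const ?_ _
    exact (ha j).comp ((differentiable_id.const_add c).differentiableOn) fun t ht => ht
  · rw [hs _ ht]
    simp only [Finset.sum_mul]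
    rw [Finset.sum_comm]
    refine Finset.sum_congr rfl fun j _ => ?_
    rw [map_add, add_comm (conj c), add_pow, Finset.mul_sum,
      Fin.sum_univ_eq_sum_range (fun i => a j (c + t) *
        (((j : ℕ).choose i : ℂ) * conj c ^ ((j : ℕ) - i)) * conj t ^ i)]
    rw [← Finset.sum_subset (Finset.range_subset_range.2 (Nat.succ_le_of_lt j.2))]
    · refine Finset.sum_congr rfl fun i _ => by ring
    · intro i _ hi
      rw [Nat.choose_eq_zero_of_lt (by simpa using hi)]
      simp
  · beta_reduce
    rw [Finset.sum_eq_single (Fin.last q)]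
    · simp
    · intro j _ hj
      rw [Nat.choose_eq_zero_of_lt (by simpa [Fin.lt_def] using Fin.lt_last_iff_ne_last.2 hj)]
      simp
    · simp

theorem translate (hg : QAnalyticOn q g U) (c : ℂ) :
    QAnalyticOn q (fun t => g (c + t)) {t | c + t ∈ U} := by
  obtain ⟨a, ha, hs⟩ := hg
  cases q with
  | zero => exact ⟨fun j => j.elim0, fun j => j.elim0, fun t ht => by simpa using hs _ ht⟩
  | succ q =>
    obtain ⟨b, hb, hbs, -⟩ := exists_translate ha hs c
    exact ⟨b, hb, hbs⟩

theorem translate_ball {c : ℂ} {R : ℝ} (hg : QAnalyticOn q g (ball c R)) :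
    QAnalyticOn q (fun t => g (c + t)) (ball 0 R) :=
  (hg.translate c).mono fun t ht => by simpa using ht

end QAnalyticOn

/-- Taylor coefficients as circle averages. -/
theorem circleAverage_inv_pow_mul {G : ℂ → ℂ} {r R : ℝ} (hr : 0 < r) (hrR : r < R)
    (hG : DifferentiableOn ℂ G (ball 0 R)) (m : ℕ) :
    Real.circleAverage (fun t => (t ^ m)⁻¹ * G t) 0 r =
      (m.factorial : ℂ)⁻¹ * iteratedDeriv m G 0 := by
  have hd : DiffContOnCl ℂ G (ball 0 r) :=
    (hG.mono ((closure_ball_subset_closedBall).trans (closedBall_subset_ball hrR))).diffContOnCl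
  have key := hd.circleIntegral_one_div_sub_center_pow_smul hr m
  rw [Real.circleAverage_eq_circleIntegral hr.ne']
  have : (∮ z in C(0, r), (z - 0)⁻¹ • ((z ^ m)⁻¹ * G z)) =
      ∮ z in C(0, r), (1 / (z - 0) ^ (m + 1)) • G z := by
    congr 1
    ext z
    simp only [sub_zero, smul_eq_mul, pow_succ, one_div, mul_inv]
    ring
  rw [this, key]
  have h2 : (2 * (Real.pi : ℂ) * Complex.I) ≠ 0 := Complex.two_pi_I_ne_zero
  simp only [smul_eq_mul]
  field_simp

theorem conj_eq_sq_div {t : ℂ} {r : ℝ} (hr : 0 < r) (ht : t ∈ sphere (0 : ℂ) r) :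
    conj t = (r : ℂ) ^ 2 * t⁻¹ := by
  have hn : ‖t‖ = r := by simpa using ht
  have h0 : t ≠ 0 := by
    rintro rfl
    simp at hn
    exact hr.ne hn
  rw [← hn, ← Complex.conj_mul' t, mul_assoc, mul_inv_cancel₀ h0, mul_one]

/-- The circle averages of a polyanalytic function are a polynomial in the squared radius. -/
theorem QAnalyticOn.exists_circleAverage_eq {q : ℕ} {g : ℂ → ℂ} {c : ℂ} {R : ℝ} (hR : 0 < R)
    (hg : QAnalyticOn q g (ball c R)) :
    ∃ P : Polynomial ℂ, P.degree < q ∧ P.eval 0 = g c ∧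
      ∀ r, 0 < r → r < R → Real.circleAverage (fun t => g (c + t)) 0 r = P.eval ((r : ℂ) ^ 2) := by
  obtain ⟨a, ha, hs⟩ := hg.translate_ball
  refine ⟨∑ j : Fin q, Polynomial.C ((((j : ℕ).factorial : ℂ)⁻¹ * iteratedDeriv j (a j) 0)) *
    Polynomial.X ^ (j : ℕ), ?_, ?_, fun r hr hrR => ?_⟩
  · refine lt_of_le_of_lt (Polynomial.degree_sum_le _ _) ?_
    refine (Finset.sup_lt_iff (WithBot.bot_lt_coe q)).2 fun j _ => ?_
    exact lt_of_le_of_lt (Polynomial.degree_C_mul_X_pow_le _ _) (Nat.cast_lt.2 j.2)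
  · have := hs 0 (by simpa using hR)
    simp only [add_zero] at this
    rw [this, Polynomial.eval_finsetSum]
    refine Finset.sum_congr rfl fun j _ => ?_
    rcases Nat.eq_zero_or_pos (j : ℕ) with h | h
    · simp [h]
    · simp [h.ne']
  · have hsub : sphere (0 : ℂ) r ⊆ ball 0 R := sphere_subset_closedBall.trans
      (closedBall_subset_ball hrR)
    have h1 : Set.EqOn (fun t => g (c + t)) (fun t => ∑ j : Fin q,
        ((r : ℂ) ^ 2) ^ (j : ℕ) * ((t ^ (j : ℕ))⁻¹ * a j t)) (sphere 0 |r|) := by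
      rw [abs_of_pos hr]
      intro t ht
      refine (hs t (hsub ht)).trans ?_
      refine Finset.sum_congr rfl fun j _ => ?_
      rw [conj_eq_sq_div hr ht, mul_pow, inv_pow]
      ring
    rw [Real.circleAverage_congr_sphere h1, Real.circleAverage_fun_sum, Polynomial.eval_finsetSum]
    · refine Finset.sum_congr rfl fun j _ => ?_
      simp_rw [← smul_eq_mul (((r : ℂ) ^ 2) ^ (j : ℕ))]
      rw [Real.circleAverage_fun_smul, circleAverage_inv_pow_mul hr hrR (ha j)]
      simp [mul_comm]
    · intro j _
      refine ContinuousOn.circleIntegrable hr.le ?_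
      refine continuousOn_const.mul (ContinuousOn.mul ?_ ((ha j).continuousOn.mono hsub))
      refine ContinuousOn.inv₀ (by fun_prop) fun t ht => pow_ne_zero _ ?_
      rintro rfl
      simp at ht
      exact hr.ne ht

/-- Lagrange interpolation of a polynomial of degree less than `q` from its values at `q` nodes. -/
theorem polynomial_eval_eq_sum_basis {q : ℕ} {v : Fin q → ℂ} (hv : Function.Injective v)
    {P : Polynomial ℂ} (hP : P.degree < q) (x : ℂ) :
    P.eval x = ∑ k, P.eval (v k) * (Lagrange.basis Finset.univ v k).eval x := by
  conv_lhs => rw [Lagrange.eq_interpolate (f := P) (s := Finset.univ) (v := v) hv.injOn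
    (by simpa using hP)]
  simp [Lagrange.interpolate_apply, Polynomial.eval_finsetSum]

open Real in
/-- The sub-mean value property of `log⁺ ‖G‖` for holomorphic `G`. -/
theorem posLog_norm_le_circleAverage {G : ℂ → ℂ} {r R : ℝ} (hr : 0 < r) (hrR : r < R)
    (hG : DifferentiableOn ℂ G (ball 0 R)) :
    log⁺ ‖G 0‖ ≤ circleAverage (fun t => log⁺ ‖G t‖) 0 r := by
  have hnn : 0 ≤ circleAverage (fun t => log⁺ ‖G t‖) 0 r :=
    circleAverage_nonneg_of_nonneg fun _ _ => posLog_nonneg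
  by_cases h0 : G 0 = 0
  · simpa [h0] using hnn
  have han : AnalyticOnNhd ℂ G (closedBall 0 |r|) := by
    rw [abs_of_pos hr]
    exact (hG.analyticOnNhd isOpen_ball).mono (closedBall_subset_ball hrR)
  have hms : MeromorphicOn G (sphere 0 |r|) := (han.mono sphere_subset_closedBall).meromorphicOn
  rw [posLog_apply]
  refine max_le hnn ?_
  calc log ‖G 0‖ ≤ circleAverage (fun t => log ‖G t‖) 0 r := by
        rw [han.circleAverage_log_norm hr.ne' h0]
        refine le_add_of_nonneg_left (finsum_nonneg fun u => ?_)
        by_cases hu : u ∈ closedBall (0 : ℂ) |r|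
        · refine mul_nonneg (by exact_mod_cast MeromorphicOn.AnalyticOnNhd.divisor_nonneg han u) ?_
          rcases eq_or_ne u 0 with rfl | hu0
          · simp
          · refine log_nonneg ?_
            have hu' : ‖u‖ ≤ r := by simpa [abs_of_pos hr] using hu
            rw [zero_sub, norm_neg, ← div_eq_mul_inv, one_le_div (norm_pos_iff.2 hu0)]
            exact hu'
        · rw [Function.locallyFinsuppWithin.apply_eq_zero_of_notMem _ hu]
          simp
    _ ≤ _ := by
        refine circleAverage_mono hms.circleIntegrable_log_norm hms.circleIntegrable_posLog_norm ?_
        intro t _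
        exact le_max_right _ _

/-- On the circle `‖t‖² = s` this is `t ^ q` times the polyanalytic function with
coefficients `a`. -/
def radialModel {q : ℕ} (a : Fin (q + 1) → ℂ → ℂ) (s t : ℂ) : ℂ :=
  ∑ j, a j t * s ^ (j : ℕ) * t ^ (q - j)

theorem radialModel_sq_norm {q : ℕ} (a : Fin (q + 1) → ℂ → ℂ) (t : ℂ) :
    radialModel a ((‖t‖ : ℂ) ^ 2) t = t ^ q * ∑ j, a j t * conj t ^ (j : ℕ) := by
  rw [radialModel, Finset.mul_sum]
  refine Finset.sum_congr rfl fun j _ => ?_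
  have : t ^ q = t ^ (j : ℕ) * t ^ (q - j) := by rw [← pow_add]; congr 1; omega
  rw [← Complex.conj_mul', this, mul_pow]
  ring

theorem radialModel_zero {q : ℕ} (a : Fin (q + 1) → ℂ → ℂ) (s : ℂ) :
    radialModel a s 0 = a (Fin.last q) 0 * s ^ q := by
  rw [radialModel, Finset.sum_eq_single (Fin.last q)]
  · simp
  · intro j _ hj
    have : q - (j : ℕ) ≠ 0 := by
      have := Fin.lt_last_iff_ne_last.2 hj
      simp [Fin.lt_def] at this
      omega
    simp [this]
  · simp

theorem radialModel_differentiableOn {q : ℕ} {a : Fin (q + 1) → ℂ → ℂ} {U : Set ℂ}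
    (ha : ∀ j, DifferentiableOn ℂ (a j) U) (s : ℂ) : DifferentiableOn ℂ (radialModel a s) U := by
  refine DifferentiableOn.fun_sum fun j _ => ((ha j).mul_const _).mul ?_
  exact (differentiable_id.pow _).differentiableOn

open Real in
theorem posLog_top_coeff_le_circleAverage {q : ℕ} {h : ℂ → ℂ} {a : Fin (q + 1) → ℂ → ℂ} {r R : ℝ}
    (hr : 0 < r) (hrR : r < R) (ha : ∀ j, DifferentiableOn ℂ (a j) (ball 0 R))
    (hs : ∀ z ∈ ball 0 R, h z = ∑ j, a j z * conj z ^ (j : ℕ)) :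
    log⁺ (r ^ q * ‖a (Fin.last q) 0‖) ≤ circleAverage (fun t => log⁺ ‖h t‖) 0 r := by
  have := posLog_norm_le_circleAverage
    (G := fun t => ((r : ℂ) ^ q)⁻¹ * radialModel a ((r : ℂ) ^ 2) t)
    hr hrR ((radialModel_differentiableOn ha _).const_mul _)
  have h0 : ‖((r : ℂ) ^ q)⁻¹ * radialModel a ((r : ℂ) ^ 2) 0‖ = r ^ q * ‖a (Fin.last q) 0‖ := by
    have : (r : ℂ) ≠ 0 := by exact_mod_cast hr.ne'
    have : ((r : ℂ) ^ q)⁻¹ * radialModel a ((r : ℂ) ^ 2) 0 = (r : ℂ) ^ q * a (Fin.last q) 0 := by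
      rw [radialModel_zero]
      field_simp
      ring
    rw [this, norm_mul, norm_pow, Complex.norm_real, norm_of_nonneg hr.le]
  rw [h0] at this
  refine this.trans_eq (circleAverage_congr_sphere ?_)
  rw [abs_of_pos hr]
  intro t ht
  have hn : ‖t‖ = r := by simpa using ht
  have htR : t ∈ ball (0 : ℂ) R := by simpa [hn] using hrR
  beta_reduce
  rw [hs t htR, ← hn, norm_mul, radialModel_sq_norm, norm_mul, norm_inv, norm_pow, norm_pow,
    Complex.norm_real, norm_norm, ← mul_assoc, inv_mul_cancel₀ (pow_ne_zero _ (hn ▸ hr.ne')),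
    one_mul]

/-- `log⁺ ‖x‖` as an extended nonnegative real. -/
def ePosLog (x : ℂ) : ℝ≥0∞ := ENNReal.ofReal (Real.posLog ‖x‖)

theorem continuous_ePosLog : Continuous ePosLog := by
  exact ENNReal.continuous_ofReal.comp (Real.continuous_posLog.comp continuous_norm)

theorem measurable_indicator_ePosLog {h : ℂ → ℂ} {U : Set ℂ} (hU : IsOpen U)
    (hh : ContinuousOn h U) : Measurable (U.indicator fun z => ePosLog (h z)) := by
  classical
  rw [← Set.piecewise_eq_indicator]
  exact (continuous_ePosLog.comp_continuousOn hh).measurable_piecewise continuousOn_const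
    hU.measurableSet

theorem ePosLog_mul (x y : ℂ) : ePosLog (x * y) ≤ ePosLog x + ePosLog y := by
  unfold ePosLog
  rw [← ENNReal.ofReal_add Real.posLog_nonneg Real.posLog_nonneg, norm_mul]
  exact ENNReal.ofReal_le_ofReal Real.posLog_mul

theorem ePosLog_add (x y : ℂ) :
    ePosLog (x + y) ≤ ENNReal.ofReal (Real.log 2) + ePosLog x + ePosLog y := by
  unfold ePosLog
  have : 0 ≤ Real.log 2 := Real.log_nonneg (by norm_num)
  rw [← ENNReal.ofReal_add this Real.posLog_nonneg, ← ENNReal.ofReal_add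
    (add_nonneg this Real.posLog_nonneg) Real.posLog_nonneg]
  refine ENNReal.ofReal_le_ofReal ?_
  have := Real.posLog_norm_add_le x y
  linarith

theorem ePosLog_mono {x y : ℂ} (h : ‖x‖ ≤ ‖y‖) : ePosLog x ≤ ePosLog y :=
  ENNReal.ofReal_le_ofReal (Real.posLog_le_posLog (norm_nonneg _) h)

theorem ePosLog_zero : ePosLog 0 = 0 := by simp [ePosLog]

theorem ePosLog_ne_top (x : ℂ) : ePosLog x ≠ ∞ := ENNReal.ofReal_ne_top

theorem ePosLog_neg (x : ℂ) : ePosLog (-x) = ePosLog x := by simp [ePosLog]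

open Real in
theorem ofReal_circleAverage_posLog {h : ℂ → ℂ} {r : ℝ} (hr : 0 < r)
    (hh : ContinuousOn h (sphere 0 r)) :
    ENNReal.ofReal (2 * π) * ENNReal.ofReal (circleAverage (fun t => log⁺ ‖h t‖) 0 r) =
      ∫⁻ θ in Set.Ioo (-π) π, ePosLog (h (circleMap 0 r θ)) := by
  have hc : Continuous fun θ => log⁺ ‖h (circleMap 0 r θ)‖ := by
    have : Continuous fun θ => h (circleMap 0 r θ) :=
      hh.comp_continuous (continuous_circleMap 0 r) fun θ => circleMap_mem_sphere 0 hr.le θ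
    exact Real.continuous_posLog.comp this.norm
  rw [← ENNReal.ofReal_mul (by positivity), circleAverage_eq_integral_add (-π), smul_eq_mul,
    ← mul_assoc, mul_inv_cancel₀ (by positivity), one_mul,
    intervalIntegral.integral_comp_add_right (fun θ => log⁺ ‖h (circleMap 0 r θ)‖)]
  rw [show 0 + -π = -π by ring, show 2 * π + -π = π by ring,
    intervalIntegral.integral_of_le (by linarith [pi_pos]), integral_Ioc_eq_integral_Ioo,
    ofReal_integral_eq_lintegral_ofReal]
  · rfl
  · exact (hc.integrableOn_Icc).mono_set Set.Ioo_subset_Icc_self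
  · exact ae_of_all _ fun _ => posLog_nonneg

open Real in
/-- Area version of the sub-mean value inequality for the top coefficient. -/
theorem exists_ePosLog_top_coeff_le (q : ℕ) {s : ℝ} (hs : 0 < s) :
    ∃ A B : ℝ≥0, ∀ (h : ℂ → ℂ) (a : Fin (q + 1) → ℂ → ℂ),
      (∀ j, DifferentiableOn ℂ (a j) (ball 0 s)) →
      (∀ z ∈ ball 0 s, h z = ∑ j, a j z * conj z ^ (j : ℕ)) →
      ePosLog (a (Fin.last q) 0) ≤ A * (∫⁻ t in ball (0 : ℂ) s, ePosLog (h t)) + B := by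
  set k : ℝ := (s / 2) * (s / 2) * (2 * π) with hk
  have hk0 : 0 < k := by positivity
  refine ⟨(k⁻¹).toNNReal, (ePosLog (((s / 2 : ℝ) : ℂ) ^ q)⁻¹).toNNReal, fun h a ha hsum => ?_⟩
  have hcont : ContinuousOn h (ball 0 s) :=
    QAnalyticOn.continuousOn (q := q + 1) ⟨a, ha, hsum⟩
  set F : ℂ → ℝ≥0∞ := (ball (0 : ℂ) s).indicator fun z => ePosLog (h z) with hF
  have hFm : Measurable F := measurable_indicator_ePosLog isOpen_ball hcont
  set b : ℂ := ((s / 2 : ℝ) : ℂ) ^ q * a (Fin.last q) 0 with hb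
  have hs2 : ((s / 2 : ℝ) : ℂ) ^ q ≠ 0 := pow_ne_zero _ (by exact_mod_cast (half_pos hs).ne')
  have hsym : ∀ r θ : ℝ, Complex.polarCoord.symm (r, θ) = circleMap 0 r θ := by
    intro r θ
    rw [Complex.polarCoord_symm_apply, circleMap_zero, Complex.exp_mul_I]
    push_cast
    rfl
  have hmain : ENNReal.ofReal k * ePosLog b ≤ ∫⁻ t in ball (0 : ℂ) s, ePosLog (h t) := by
    rw [← lintegral_indicator measurableSet_ball, ← Complex.lintegral_comp_polarCoord_symm,
      polarCoord_target, Measure.volume_eq_prod, ← Measure.prod_restrict, lintegral_prod]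
    · calc ENNReal.ofReal k * ePosLog b
          = ∫⁻ r in Set.Ioo (s / 2) s, ENNReal.ofReal (s / 2) *
              (ENNReal.ofReal (2 * π) * ePosLog b) := by
            rw [setLIntegral_const, Real.volume_Ioo, hk, ENNReal.ofReal_mul (by positivity),
              ENNReal.ofReal_mul (by positivity), show s - s / 2 = s / 2 by ring]
            ring
        _ ≤ ∫⁻ r in Set.Ioo (s / 2) s, ∫⁻ θ in Set.Ioo (-π) π,
              ENNReal.ofReal r • F (Complex.polarCoord.symm (r, θ)) := by
            refine setLIntegral_mono' measurableSet_Ioo fun r hr => ?_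
            have hr0 : 0 < r := (half_pos hs).trans hr.1
            simp only [smul_eq_mul]
            rw [lintegral_const_mul' _ _ ENNReal.ofReal_ne_top]
            refine mul_le_mul' (ENNReal.ofReal_le_ofReal hr.1.le) ?_
            have hsub : sphere (0 : ℂ) r ⊆ ball 0 s :=
              sphere_subset_closedBall.trans (closedBall_subset_ball hr.2)
            have e : ∀ θ, F (Complex.polarCoord.symm (r, θ)) = ePosLog (h (circleMap 0 r θ)) := by
              intro θ
              rw [hsym, hF, Set.indicator_of_mem (hsub (circleMap_mem_sphere 0 hr0.le θ))]
            simp only [e]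
            rw [← ofReal_circleAverage_posLog hr0 (hcont.mono hsub)]
            gcongr
            refine ENNReal.ofReal_le_ofReal ?_
            refine le_trans ?_ (posLog_top_coeff_le_circleAverage hr0 hr.2 ha hsum)
            refine posLog_le_posLog (norm_nonneg _) ?_
            rw [hb, norm_mul, norm_pow, Complex.norm_real, norm_of_nonneg (half_pos hs).le]
            gcongr
            exact hr.1.le
        _ ≤ _ := lintegral_mono_set fun r hr => (half_pos hs).trans hr.1
    · refine Measurable.aemeasurable ?_
      refine Measurable.smul (ENNReal.measurable_ofReal.comp measurable_fst) (hFm.comp ?_)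
      have : Continuous fun p : ℝ × ℝ => Complex.polarCoord.symm p := by
        simp only [Complex.polarCoord_symm_apply]
        fun_prop
      exact this.measurable
  have hk1 : ePosLog b ≤ ((k⁻¹).toNNReal : ℝ≥0∞) * ∫⁻ t in ball (0 : ℂ) s, ePosLog (h t) := by
    have : ((k⁻¹).toNNReal : ℝ≥0∞) * ENNReal.ofReal k = 1 := by
      change ENNReal.ofReal k⁻¹ * _ = 1
      rw [← ENNReal.ofReal_mul (by positivity), inv_mul_cancel₀ hk0.ne', ENNReal.ofReal_one]
    calc ePosLog b = ((k⁻¹).toNNReal : ℝ≥0∞) * (ENNReal.ofReal k * ePosLog b) := by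
          rw [← mul_assoc, this, one_mul]
      _ ≤ _ := by gcongr
  calc ePosLog (a (Fin.last q) 0) = ePosLog (b * (((s / 2 : ℝ) : ℂ) ^ q)⁻¹) := by
        rw [hb]; congr 1; field_simp
    _ ≤ ePosLog b + ePosLog (((s / 2 : ℝ) : ℂ) ^ q)⁻¹ := ePosLog_mul _ _
    _ ≤ _ := by
        rw [ENNReal.coe_toNNReal (ePosLog_ne_top _)]
        exact add_le_add hk1 le_rfl

theorem setLIntegral_ball_add_left (F : ℂ → ℝ≥0∞) (z : ℂ) (s : ℝ) :
    ∫⁻ t in ball (0 : ℂ) s, F (z + t) = ∫⁻ t in ball z s, F t := by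
  rw [← lintegral_indicator measurableSet_ball, ← lintegral_indicator measurableSet_ball,
    ← lintegral_add_left_eq_self ((ball z s).indicator fun t => F t) z]
  congr 1
  ext t
  simp [Set.indicator]

/-- Local boundedness of `log⁺ ‖h‖` in terms of its mean, for polyanalytic `h`. -/
theorem QAnalyticOn.exists_ePosLog_le (q : ℕ) : ∀ (c : ℂ) {r R : ℝ}, r < R →
    ∃ A B : ℝ≥0, ∀ h, QAnalyticOn q h (ball c R) → ∀ z ∈ ball c r,
      ePosLog (h z) ≤ A * (∫⁻ t in ball c R, ePosLog (h t)) + B := by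
  induction q with
  | zero =>
    intro c r R hrR
    refine ⟨0, 0, fun h hh z hz => ?_⟩
    obtain ⟨a, -, hs⟩ := hh
    rw [hs z (ball_subset_ball hrR.le hz)]
    simp [ePosLog_zero]
  | succ q ih =>
    intro c r R hrR
    have hs0 : 0 < (R - r) / 2 := by linarith
    obtain ⟨A₀, B₀, htop⟩ := exists_ePosLog_top_coeff_le q hs0
    obtain ⟨A₁, B₁, hA₁⟩ := ih c (r := r) (R := (r + R) / 2) (by linarith)
    set l : ℝ≥0 := (Real.log 2).toNNReal with hl
    set D : ℝ≥0 := (Real.posLog ‖(((‖c‖ + |R| : ℝ) : ℂ) ^ q)‖).toNNReal with hD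
    set V : ℝ≥0 := (volume (ball c R)).toNNReal with hV
    have hVe : (V : ℝ≥0∞) = volume (ball c R) := ENNReal.coe_toNNReal measure_ball_lt_top.ne
    refine ⟨A₁ * A₀ * V + A₁ + A₀, l + A₁ * (l + B₀ + D) * V + B₁ + B₀ + D, fun h hh z hz => ?_⟩
    have hcont := hh.continuousOn
    obtain ⟨a, ha, hsum⟩ := hh
    set I := ∫⁻ t in ball c R, ePosLog (h t) with hI
    have hsub : ball c ((r + R) / 2) ⊆ ball c R := ball_subset_ball (by linarith)
    have htop' : ∀ w ∈ ball c ((r + R) / 2), ePosLog (a (Fin.last q) w) ≤ A₀ * I + B₀ := by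
      intro w hw
      have hw' : ball w ((R - r) / 2) ⊆ ball c R := by
        refine ball_subset_ball' ?_
        have := mem_ball.1 hw
        linarith
      have hmem : ∀ t ∈ ball (0 : ℂ) ((R - r) / 2), w + t ∈ ball c R := fun t ht =>
        hw' (by simpa using ht)
      obtain ⟨b, hb, hbs, hbt⟩ := QAnalyticOn.exists_translate ha hsum w
      have := htop (fun t => h (w + t)) b (fun j => (hb j).mono hmem) fun t ht => hbs t (hmem t ht)
      rw [hbt 0, add_zero, setLIntegral_ball_add_left (fun t => ePosLog (h t))] at this
      refine this.trans ?_
      gcongr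
      exact lintegral_mono_set hw'
    set e : ℂ → ℂ := fun w => a (Fin.last q) w * conj w ^ q with he
    have heb : ∀ w ∈ ball c ((r + R) / 2), ePosLog (e w) ≤ A₀ * I + B₀ + D := by
      intro w hw
      refine (ePosLog_mul _ _).trans (add_le_add (htop' w hw) ?_)
      refine ePosLog_mono ?_
      rw [norm_pow, norm_pow, RCLike.norm_conj, Complex.norm_real]
      gcongr
      have h1 := mem_ball_iff_norm.1 (hsub hw)
      have h2 : ‖w‖ ≤ ‖w - c‖ + ‖c‖ := by simpa using norm_add_le (w - c) c
      rw [Real.norm_of_nonneg (by positivity)]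
      linarith [le_abs_self R]
    have hk : QAnalyticOn q (fun w => h w - e w) (ball c ((r + R) / 2)) := by
      refine ⟨fun j => a j.castSucc, fun j => (ha _).mono hsub, fun w hw => ?_⟩
      beta_reduce
      rw [hsum w (hsub hw), Fin.sum_univ_castSucc]
      simp [he]
    have hkI : ∫⁻ w in ball c ((r + R) / 2), ePosLog (h w - e w) ≤
        I + (l + (A₀ * I + B₀ + D)) * V := by
      calc ∫⁻ w in ball c ((r + R) / 2), ePosLog (h w - e w)
          ≤ ∫⁻ w in ball c ((r + R) / 2), (ePosLog (h w) + (l + (A₀ * I + B₀ + D))) := by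
            refine setLIntegral_mono' measurableSet_ball fun w hw => ?_
            rw [sub_eq_add_neg]
            refine (ePosLog_add _ _).trans ?_
            rw [ePosLog_neg]
            have := heb w hw
            calc ENNReal.ofReal (Real.log 2) + ePosLog (h w) + ePosLog (e w)
                ≤ l + ePosLog (h w) + (A₀ * I + B₀ + D) := by gcongr; exact le_rfl
              _ = _ := by ring
        _ ≤ ∫⁻ w in ball c R, (ePosLog (h w) + (l + (A₀ * I + B₀ + D))) :=
            lintegral_mono_set hsub
        _ = _ := by
            rw [lintegral_add_right _ measurable_const, setLIntegral_const, hVe]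
    have hz' : z ∈ ball c ((r + R) / 2) := ball_subset_ball (by linarith) hz
    calc ePosLog (h z) = ePosLog ((h z - e z) + e z) := by rw [sub_add_cancel]
      _ ≤ l + ePosLog (h z - e z) + ePosLog (e z) := ePosLog_add _ _
      _ ≤ l + (A₁ * (I + (l + (A₀ * I + B₀ + D)) * V) + B₁) + (A₀ * I + B₀ + D) := by
          gcongr
          · exact (hA₁ _ hk z hz).trans (by gcongr)
          · exact heb z hz'
      _ = _ := by push_cast; ring

/-- The estimate of `QAnalyticOn.exists_ePosLog_le` passes to bounded pointwise limits. -/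
theorem ePosLog_le_of_tendsto {q : ℕ} {c : ℂ} {r R : ℝ} {A B : ℝ≥0} (hrR : r < R)
    (hAB : ∀ h, QAnalyticOn q h (ball c R) → ∀ z ∈ ball c r,
      ePosLog (h z) ≤ A * (∫⁻ t in ball c R, ePosLog (h t)) + B)
    {g : ℕ → ℂ → ℂ} {h : ℂ → ℂ} {M : ℝ} (hg : ∀ N, QAnalyticOn q (g N) (ball c R))
    (hM : ∀ N, ∀ z ∈ ball c R, ‖g N z‖ ≤ M)
    (hlim : ∀ z ∈ ball c R, Tendsto (fun N => g N z) atTop (𝓝 (h z))) {z : ℂ} (hz : z ∈ ball c r) :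
    ePosLog (h z) ≤ A * (∫⁻ t in ball c R, ePosLog (h t)) + B := by
  have hT : Tendsto (fun N => ∫⁻ t in ball c R, ePosLog (g N t)) atTop
      (𝓝 (∫⁻ t in ball c R, ePosLog (h t))) := by
    refine tendsto_lintegral_of_dominated_convergence' (fun _ => ePosLog (M : ℂ)) (fun N => ?_)
      (fun N => ?_) ?_ ?_
    · exact (continuous_ePosLog.comp_continuousOn (hg N).continuousOn).aemeasurable
        measurableSet_ball
    · refine (ae_restrict_iff' measurableSet_ball).2 (ae_of_all _ fun w hw => ePosLog_mono ?_)
      rw [Complex.norm_real]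
      exact (hM N w hw).trans (le_abs_self M)
    · rw [setLIntegral_const]
      exact ENNReal.mul_ne_top (ePosLog_ne_top _) measure_ball_lt_top.ne
    · refine (ae_restrict_iff' measurableSet_ball).2 (ae_of_all _ fun w hw => ?_)
      exact (continuous_ePosLog.tendsto _).comp (hlim w hw)
  have h1 : Tendsto (fun N => ePosLog (g N z)) atTop (𝓝 (ePosLog (h z))) :=
    (continuous_ePosLog.tendsto _).comp (hlim z (ball_subset_ball hrR.le hz))
  refine le_of_tendsto_of_tendsto' h1 ?_ fun N => hAB _ (hg N) z hz
  exact (ENNReal.Tendsto.const_mul hT (Or.inr ENNReal.coe_ne_top)).add_const _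

theorem Fin.cons_mem_ball_iff {n : ℕ} {p : Fin (n + 1) → ℂ} {r : ℝ} (hr : 0 < r) {ζ : ℂ}
    {z : Fin n → ℂ} : (Fin.cons ζ z : Fin (n + 1) → ℂ) ∈ ball p r ↔
      ζ ∈ ball (p 0) r ∧ z ∈ ball (Fin.tail p) r := by
  simp only [mem_ball, dist_pi_lt_iff hr, Fin.forall_fin_succ, Fin.cons_zero, Fin.cons_succ,
    Fin.tail]

theorem continuous_finCons {n : ℕ} (ζ : ℂ) :
    Continuous fun z : Fin n → ℂ => (Fin.cons ζ z : Fin (n + 1) → ℂ) := by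
  refine continuous_pi fun j => ?_
  refine Fin.cases ?_ (fun i => ?_) j
  · simpa using continuous_const
  · simpa using continuous_apply i

theorem continuous_finCons_left {n : ℕ} (z : Fin n → ℂ) :
    Continuous fun ζ : ℂ => (Fin.cons ζ z : Fin (n + 1) → ℂ) := by
  refine continuous_pi fun j => ?_
  refine Fin.cases ?_ (fun i => ?_) j
  · simpa only [Fin.cons_zero] using continuous_id'
  · simpa using continuous_const

theorem lowerSemicontinuous_indicator_of_continuousOn {X : Type*} [TopologicalSpace X] {U : Set X}
    (hU : IsOpen U) {f : X → ℝ≥0∞} (hf : ContinuousOn f U) :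
    LowerSemicontinuous (U.indicator f) := by
  refine lowerSemicontinuous_iff_isOpen_preimage.2 fun y => ?_
  convert hf.isOpen_inter_preimage hU (isOpen_Ioi (a := y)) using 1
  ext x
  by_cases hx : x ∈ U <;> simp [hx]

/-- A Hartogs-type lemma: pointwise decay of separately quasi-subharmonic functions is locally
uniform. -/
theorem eventually_uniform_le_of_slice_mean (n : ℕ) :
    ∀ (z₀ : Fin n → ℂ) (ρ₀ : ℝ) (L : ℝ≥0) (u : ℕ → (Fin n → ℂ) → ℝ≥0∞),
    (∀ m, ContinuousOn (u m) (ball z₀ ρ₀)) →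
    (∀ m : ℕ, ∀ z ∈ ball z₀ ρ₀, u m z ≤ L * (m + 1)) →
    (∀ z ∈ ball z₀ ρ₀, Tendsto (fun m : ℕ => u m z / (m + 1)) atTop (𝓝 0)) →
    (∀ j, ∀ r < ρ₀, ∃ A B : ℝ≥0, ∀ m, ∀ z ∈ ball z₀ ρ₀, dist (z j) (z₀ j) < r →
      u m z ≤ A * (∫⁻ ζ in ball (z₀ j) ρ₀, u m (Function.update z j ζ)) + B) →
    ∀ ρ₁ < ρ₀, ∀ ε : ℝ≥0∞, 0 < ε →
      ∀ᶠ m : ℕ in atTop, ∀ z ∈ ball z₀ ρ₁, u m z ≤ ε * (m + 1) := by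
  have hc0 : ∀ m : ℕ, ((m : ℝ≥0∞) + 1) ≠ 0 := fun m => by simp
  have hct : ∀ m : ℕ, ((m : ℝ≥0∞) + 1) ≠ ∞ := fun m => by simp
  induction n with
  | zero =>
    intro z₀ ρ₀ L u _ _ hlim _ ρ₁ hρ ε hε
    by_cases h0 : 0 < ρ₀
    · filter_upwards [(tendsto_order.1 (hlim z₀ (mem_ball_self h0))).2 ε hε] with m hm z _
      rw [Subsingleton.elim z z₀]
      exact (ENNReal.div_le_iff (hc0 m) (hct m)).1 hm.le
    · refine Eventually.of_forall fun m z hz => ?_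
      exact absurd (pos_of_mem_ball hz) (by linarith)
  | succ n ih =>
    intro z₀ ρ₀ L u hcont hL hlim hqm ρ₁ hρ ε hε
    by_cases hρ₁ : 0 < ρ₁
    swap
    · refine Eventually.of_forall fun m z hz => ?_
      exact absurd (pos_of_mem_ball hz) hρ₁
    have hρ₀ := hρ₁.trans hρ
    set b := Fin.tail z₀ with hb
    have hmem : ∀ {ζ z}, ζ ∈ ball (z₀ 0) ρ₀ → z ∈ ball b ρ₀ →
        (Fin.cons ζ z : Fin (n + 1) → ℂ) ∈ ball z₀ ρ₀ := fun h1 h2 =>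
      (Fin.cons_mem_ball_iff hρ₀).2 ⟨h1, h2⟩
    set S : ℕ → ℂ → ℝ≥0∞ := fun m ζ => ⨆ z ∈ ball b ρ₁,
      (ball (z₀ 0) ρ₀).indicator (fun ζ => u m (Fin.cons ζ z)) ζ with hS
    have hSm : ∀ m, Measurable (S m) := by
      intro m
      refine LowerSemicontinuous.measurable (lowerSemicontinuous_biSup fun z hz => ?_)
      refine lowerSemicontinuous_indicator_of_continuousOn isOpen_ball ?_
      exact (hcont m).comp (continuous_finCons_left z).continuousOn fun ζ hζ =>
        hmem hζ (ball_subset_ball hρ.le hz)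
    have hle : ∀ m, ∀ ζ ∈ ball (z₀ 0) ρ₀, ∀ z ∈ ball b ρ₁, u m (Fin.cons ζ z) ≤ S m ζ := by
      intro m ζ hζ z hz
      refine le_trans (le_of_eq ?_) (le_iSup₂ (f := fun z (_ : z ∈ ball b ρ₁) =>
        (ball (z₀ 0) ρ₀).indicator (fun ζ => u m (Fin.cons ζ z)) ζ) z hz)
      rw [Set.indicator_of_mem hζ]
    have hSle : ∀ m, ∀ ζ ∈ ball (z₀ 0) ρ₀, ∀ K : ℝ≥0∞,
        (∀ z ∈ ball b ρ₁, u m (Fin.cons ζ z) ≤ K) → S m ζ ≤ K := by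
      intro m ζ hζ K hK
      refine iSup₂_le fun z hz => ?_
      rw [Set.indicator_of_mem hζ]
      exact hK z hz
    have hSlim : ∀ ζ ∈ ball (z₀ 0) ρ₀, Tendsto (fun m : ℕ => S m ζ / (m + 1)) atTop (𝓝 0) := by
      intro ζ hζ
      refine ENNReal.tendsto_nhds_zero.2 fun δ hδ => ?_
      have := ih b ρ₀ L (fun m z => u m (Fin.cons ζ z))
        (fun m => (hcont m).comp (continuous_finCons ζ).continuousOn fun z hz => hmem hζ hz)
        (fun m z hz => hL m _ (hmem hζ hz)) (fun z hz => hlim _ (hmem hζ hz))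
        (fun j r hr => by
          obtain ⟨A, B, h⟩ := hqm j.succ r hr
          refine ⟨A, B, fun m z hz hzr => ?_⟩
          have := h m (Fin.cons ζ z) (hmem hζ hz) hzr
          simp only [← Fin.cons_update] at this
          exact this) ρ₁ hρ δ hδ
      filter_upwards [this] with m hm
      exact (ENNReal.div_le_iff (hc0 m) (hct m)).2 (hSle m ζ hζ _ hm)
    have hInt : Tendsto (fun m : ℕ => ∫⁻ ζ in ball (z₀ 0) ρ₀, S m ζ / (m + 1)) atTop (𝓝 0) := by
      have := tendsto_lintegral_of_dominated_convergence (μ := volume.restrict (ball (z₀ 0) ρ₀))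
        (F := fun (m : ℕ) ζ => S m ζ / (m + 1)) (f := fun _ => 0) (fun _ => (L : ℝ≥0∞))
        (fun m => (hSm m).div_const _) (fun m => ?_) ?_ ?_
      · simpa using this
      · refine (ae_restrict_iff' measurableSet_ball).2 (ae_of_all _ fun ζ hζ => ?_)
        refine (ENNReal.div_le_iff (hc0 m) (hct m)).2 (hSle m ζ hζ _ fun z hz => ?_)
        exact hL m _ (hmem hζ (ball_subset_ball hρ.le hz))
      · rw [setLIntegral_const]
        exact ENNReal.mul_ne_top ENNReal.coe_ne_top measure_ball_lt_top.ne
      · exact (ae_restrict_iff' measurableSet_ball).2 (ae_of_all _ hSlim)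
    obtain ⟨A, B, hAB⟩ := hqm 0 ρ₁ hρ
    have hT : Tendsto (fun m : ℕ => A * (∫⁻ ζ in ball (z₀ 0) ρ₀, S m ζ / (m + 1)) +
        (B : ℝ≥0∞) / (m + 1)) atTop (𝓝 0) := by
      have h1 : Tendsto (fun m : ℕ => (m : ℝ≥0∞) + 1) atTop (𝓝 ∞) := by
        have := (tendsto_add_atTop_iff_nat (f := fun m : ℕ => (m : ℝ≥0∞)) 1).2
          ENNReal.tendsto_nat_nhds_top
        simpa using this
      have h2 : Tendsto (fun m : ℕ => (B : ℝ≥0∞) / (m + 1)) atTop (𝓝 0) := by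
        have := ENNReal.Tendsto.const_div h1 (Or.inr (ENNReal.coe_ne_top (r := B)))
        simpa using this
      simpa using (ENNReal.Tendsto.const_mul hInt (Or.inr (ENNReal.coe_ne_top (r := A)))).add h2
    filter_upwards [(tendsto_order.1 hT).2 ε hε] with m hm z hz
    obtain ⟨hz0, hzt⟩ : z 0 ∈ ball (z₀ 0) ρ₁ ∧ Fin.tail z ∈ ball b ρ₁ := by
      rw [← Fin.cons_mem_ball_iff hρ₁, Fin.cons_self_tail]
      exact hz
    refine (ENNReal.div_le_iff (hc0 m) (hct m)).1 (le_trans ?_ hm.le)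
    have h1 : u m z ≤ A * (∫⁻ ζ in ball (z₀ 0) ρ₀, S m ζ) + B := by
      refine (hAB m z (ball_subset_ball hρ.le hz) hz0).trans ?_
      gcongr 2
      refine setLIntegral_mono' measurableSet_ball fun ζ hζ => ?_
      rw [← Fin.cons_self_tail z, Fin.update_cons_zero]
      exact hle m ζ hζ _ hzt
    calc u m z / (m + 1) ≤ (A * (∫⁻ ζ in ball (z₀ 0) ρ₀, S m ζ) + B) / (m + 1) := by gcongr
      _ = _ := by
        simp only [div_eq_mul_inv]
        rw [lintegral_mul_const _ (hSm m)]
        ring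

/-- Polyanalyticity in each variable separately. -/
def SepQAnalyticOn {n : ℕ} (α : Fin n → ℕ) (f : (Fin n → ℂ) → ℂ) (Ω : Set (Fin n → ℂ)) : Prop :=
  ∀ (j : Fin n) (c : Fin n → ℂ),
    QAnalyticOn (α j) (fun ζ => f (Function.update c j ζ)) {ζ : ℂ | Function.update c j ζ ∈ Ω}

theorem update_mem_ball {n : ℕ} {z z₀ : Fin n → ℂ} {ρ : ℝ} (hz : z ∈ ball z₀ ρ) {j : Fin n} {ζ : ℂ}
    (hζ : ζ ∈ ball (z₀ j) ρ) : Function.update z j ζ ∈ ball z₀ ρ := by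
  have hρ := pos_of_mem_ball hz
  rw [mem_ball, dist_pi_lt_iff hρ] at hz ⊢
  intro i
  rcases eq_or_ne i j with rfl | hi
  · simpa using hζ
  · simpa [hi] using hz i

namespace SepQAnalyticOn

variable {n : ℕ} {α : Fin n → ℕ} {f : (Fin n → ℂ) → ℂ} {Ω Ω' : Set (Fin n → ℂ)}

theorem mono (hf : SepQAnalyticOn α f Ω) (h : Ω' ⊆ Ω) : SepQAnalyticOn α f Ω' :=
  fun j c => (hf j c).mono fun _ hζ => h hζ

theorem const_mul (hf : SepQAnalyticOn α f Ω) (c : ℂ) : SepQAnalyticOn α (fun z => c * f z) Ω :=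
  fun j p => (hf j p).const_mul c

theorem sum {ι : Type*} (s : Finset ι) {F : ι → (Fin n → ℂ) → ℂ}
    (hF : ∀ i ∈ s, SepQAnalyticOn α (F i) Ω) : SepQAnalyticOn α (fun z => ∑ i ∈ s, F i z) Ω :=
  fun j p => QAnalyticOn.sum s fun i hi => hF i hi j p

theorem slice (hf : SepQAnalyticOn α f Ω) {z z₀ : Fin n → ℂ} {ρ : ℝ} (hΩ : ball z₀ ρ ⊆ Ω)
    (hz : z ∈ ball z₀ ρ) (j : Fin n) :
    QAnalyticOn (α j) (fun ζ => f (Function.update z j ζ)) (ball (z₀ j) ρ) :=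
  (hf j z).mono fun _ hζ => hΩ (update_mem_ball hz hζ)

end SepQAnalyticOn

/-- Pointwise geometric growth of a sequence of separately polyanalytic functions (or limits of
such) is locally uniform. -/
theorem exists_uniform_growth_bound {n : ℕ} {α : Fin n → ℕ} {z₀ : Fin n → ℂ} {ρ₀ : ℝ}
    {h : ℕ → (Fin n → ℂ) → ℂ} (hcont : ∀ m, ContinuousOn (h m) (ball z₀ ρ₀))
    (happrox : ∀ m, ∃ (g : ℕ → (Fin n → ℂ) → ℂ) (M : ℝ),
      (∀ N, SepQAnalyticOn α (g N) (ball z₀ ρ₀)) ∧ (∀ N, ∀ z ∈ ball z₀ ρ₀, ‖g N z‖ ≤ M) ∧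
      ∀ z ∈ ball z₀ ρ₀, Tendsto (fun N => g N z) atTop (𝓝 (h m z)))
    {L : ℝ} (hL1 : 1 ≤ L) (hL : ∀ m, ∀ z ∈ ball z₀ ρ₀, ‖h m z‖ ≤ L ^ (m + 1))
    {ρ : ℝ} (hρ : 0 < ρ) (hpt : ∀ z ∈ ball z₀ ρ₀, ∃ C, ∀ m, ‖h m z‖ ≤ C * ρ ^ m)
    {ρ₁ : ℝ} (hρ₁ : ρ₁ < ρ₀) {ρ' : ℝ} (hρ' : ρ < ρ') :
    ∃ C, ∀ m, ∀ z ∈ ball z₀ ρ₁, ‖h m z‖ ≤ C * ρ' ^ m := by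
  set u : ℕ → (Fin n → ℂ) → ℝ≥0∞ := fun m z => ePosLog (((ρ : ℂ) ^ m)⁻¹ * h m z) with hu
  have hnorm : ∀ m z, ‖((ρ : ℂ) ^ m)⁻¹ * h m z‖ = (ρ ^ m)⁻¹ * ‖h m z‖ := by
    intro m z
    rw [norm_mul, norm_inv, norm_pow, Complex.norm_real, Real.norm_of_nonneg hρ.le]
  set K : ℝ := Real.posLog ρ⁻¹ + Real.log L with hK
  have hlogL : 0 ≤ Real.log L := Real.log_nonneg hL1
  have hK0 : 0 ≤ K := add_nonneg Real.posLog_nonneg hlogL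
  have huL : ∀ m : ℕ, ∀ z ∈ ball z₀ ρ₀, u m z ≤ K.toNNReal * (m + 1) := by
    intro m z hz
    have h1 : Real.posLog ((ρ ^ m)⁻¹ * ‖h m z‖) ≤ K * (m + 1) := by
      calc Real.posLog ((ρ ^ m)⁻¹ * ‖h m z‖) ≤ Real.posLog (ρ ^ m)⁻¹ + Real.posLog ‖h m z‖ :=
            Real.posLog_mul
        _ ≤ m * Real.posLog ρ⁻¹ + (m + 1) * Real.log L := by
            refine add_le_add ?_ ?_
            · rw [← inv_pow, Real.posLog_pow]
            · refine (Real.posLog_le_posLog (norm_nonneg _) (hL m z hz)).trans_eq ?_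
              rw [Real.posLog_pow, Real.posLog_eq_log (by rwa [abs_of_nonneg (by linarith)])]
              push_cast
              ring
        _ ≤ _ := by
            rw [hK]
            nlinarith [Real.posLog_nonneg (x := ρ⁻¹)]
    calc u m z = ENNReal.ofReal (Real.posLog ((ρ ^ m)⁻¹ * ‖h m z‖)) := by
          simp only [hu, ePosLog, hnorm]
      _ ≤ ENNReal.ofReal (K * (m + 1)) := ENNReal.ofReal_le_ofReal h1
      _ = _ := by
          rw [ENNReal.ofReal_mul hK0, ENNReal.ofReal_add (by positivity) zero_le_one]
          simp
          rfl
  have hulim : ∀ z ∈ ball z₀ ρ₀, Tendsto (fun m : ℕ => u m z / (m + 1)) atTop (𝓝 0) := by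
    intro z hz
    obtain ⟨C, hC⟩ := hpt z hz
    have h1 : Tendsto (fun m : ℕ => (m : ℝ≥0∞) + 1) atTop (𝓝 ∞) := by
      have := (tendsto_add_atTop_iff_nat (f := fun m : ℕ => (m : ℝ≥0∞)) 1).2
        ENNReal.tendsto_nat_nhds_top
      simpa using this
    have h2 : Tendsto (fun m : ℕ => ePosLog (C : ℂ) / ((m : ℝ≥0∞) + 1)) atTop (𝓝 0) := by
      have := ENNReal.Tendsto.const_div h1 (Or.inr (ePosLog_ne_top (C : ℂ)))
      simpa using this
    refine tendsto_of_tendsto_of_tendsto_of_le_of_le tendsto_const_nhds h2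
      (fun _ => zero_le) fun m => ?_
    refine ENNReal.div_le_div_right (ePosLog_mono ?_) _
    rw [hnorm, Complex.norm_real]
    refine le_trans ?_ (le_abs_self C)
    rw [inv_mul_le_iff₀ (by positivity), mul_comm]
    exact hC m
  have hqm : ∀ j, ∀ r < ρ₀, ∃ A B : ℝ≥0, ∀ m, ∀ z ∈ ball z₀ ρ₀, dist (z j) (z₀ j) < r →
      u m z ≤ A * (∫⁻ ζ in ball (z₀ j) ρ₀, u m (Function.update z j ζ)) + B := by
    intro j r hr
    obtain ⟨A, B, hAB⟩ := QAnalyticOn.exists_ePosLog_le (α j) (z₀ j) hr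
    refine ⟨A, B, fun m z hz hzr => ?_⟩
    obtain ⟨g, M, hgS, hgM, hgl⟩ := happrox m
    have := ePosLog_le_of_tendsto (g := fun N ζ => ((ρ : ℂ) ^ m)⁻¹ * g N (Function.update z j ζ))
      (h := fun ζ => ((ρ : ℂ) ^ m)⁻¹ * h m (Function.update z j ζ)) (M := (ρ ^ m)⁻¹ * M) hr hAB
      (fun N => ((hgS N).slice subset_rfl hz j).const_mul _)
      (fun N ζ hζ => ?_) (fun ζ hζ => ?_) (z := z j) hzr
    · simpa only [Function.update_eq_self] using this
    · rw [norm_mul, norm_inv, norm_pow, Complex.norm_real, Real.norm_of_nonneg hρ.le]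
      gcongr
      exact hgM N _ (update_mem_ball hz hζ)
    · exact (hgl _ (update_mem_ball hz hζ)).const_mul _
  have hρ'0 : 0 < ρ' := hρ.trans hρ'
  have hlog : 0 < Real.log (ρ' / ρ) := Real.log_pos ((one_lt_div hρ).2 hρ')
  have key := eventually_uniform_le_of_slice_mean n z₀ ρ₀ K.toNNReal u
    (fun m => continuous_ePosLog.comp_continuousOn (continuousOn_const.mul (hcont m))) huL hulim
    hqm ρ₁ hρ₁ (ENNReal.ofReal (Real.log (ρ' / ρ))) (ENNReal.ofReal_pos.2 hlog)
  obtain ⟨N, hN⟩ := eventually_atTop.1 key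
  refine ⟨(∑ m ∈ Finset.range N, L ^ (m + 1) / ρ' ^ m) + ρ' / ρ, fun m z hz => ?_⟩
  have hsum0 : ∀ m ∈ Finset.range N, 0 ≤ L ^ (m + 1) / ρ' ^ m := fun m _ => by positivity
  rcases lt_or_ge m N with hm | hm
  · have h1 := Finset.single_le_sum hsum0 (Finset.mem_range.2 hm)
    have h2 : 0 ≤ ρ' / ρ := by positivity
    calc ‖h m z‖ ≤ L ^ (m + 1) / ρ' ^ m * ρ' ^ m := by
          rw [div_mul_cancel₀ _ (by positivity)]
          exact hL m z (ball_subset_ball hρ₁.le hz)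
      _ ≤ _ := by gcongr; linarith
  · have h1 := hN m hm z hz
    have h2 : Real.posLog ((ρ ^ m)⁻¹ * ‖h m z‖) ≤ Real.log (ρ' / ρ) * (m + 1) := by
      have : ENNReal.ofReal (Real.log (ρ' / ρ)) * ((m : ℝ≥0∞) + 1) =
          ENNReal.ofReal (Real.log (ρ' / ρ) * (m + 1)) := by
        rw [ENNReal.ofReal_mul hlog.le, ENNReal.ofReal_add (by positivity) zero_le_one]
        simp
      rw [this, hu] at h1
      simp only [ePosLog, hnorm] at h1
      exact (ENNReal.ofReal_le_ofReal_iff (by positivity)).1 h1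
    have h3 : ‖h m z‖ ≤ ρ ^ m * (ρ' / ρ) ^ (m + 1) := by
      rw [← inv_mul_le_iff₀ (by positivity)]
      rcases eq_or_lt_of_le (norm_nonneg (h m z)) with h0 | h0
      · rw [← h0, mul_zero]; positivity
      · have h4 : 0 < (ρ ^ m)⁻¹ * ‖h m z‖ := by positivity
        rw [← Real.log_le_log_iff h4 (by positivity), Real.log_pow]
        refine (le_max_right 0 _).trans (h2.trans_eq ?_)
        push_cast
        ring
    calc ‖h m z‖ ≤ ρ ^ m * (ρ' / ρ) ^ (m + 1) := h3
      _ = ρ' / ρ * ρ' ^ m := by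
        rw [pow_succ, div_pow]
        field_simp
      _ ≤ _ := by
        gcongr
        linarith [Finset.sum_nonneg hsum0]

open scoped ContDiff

open Real in
/-- Polar coordinates in terms of circle averages. -/
theorem integral_eq_of_circleAverage_eq {w w' : ℂ → ℂ} {s : ℝ}
    (hw : Continuous w) (hw0 : ∀ t, s ≤ ‖t‖ → w t = 0)
    (hw' : Continuous w') (hw'0 : ∀ t, s ≤ ‖t‖ → w' t = 0)
    (h : ∀ r, 0 < r → circleAverage w 0 r = circleAverage w' 0 r) :
    ∫ t, w t = ∫ t, w' t := by
  have hsym : ∀ r θ : ℝ, Complex.polarCoord.symm (r, θ) = circleMap 0 r θ := by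
    intro r θ
    rw [Complex.polarCoord_symm_apply, circleMap_zero, Complex.exp_mul_I]
    push_cast
    rfl
  have key : ∀ w : ℂ → ℂ, Continuous w → (∀ t, s ≤ ‖t‖ → w t = 0) →
      ∫ t, w t = ∫ r in Set.Ioi (0 : ℝ), r • (2 * π) • circleAverage w 0 r := by
    intro w hw hw0
    have hc : Continuous fun p : ℝ × ℝ => p.1 • w (Complex.polarCoord.symm p) := by
      have : Continuous fun p : ℝ × ℝ => Complex.polarCoord.symm p := by
        simp only [Complex.polarCoord_symm_apply]
        fun_prop
      exact continuous_fst.smul (hw.comp this)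
    rw [← Complex.integral_comp_polarCoord_symm, polarCoord_target, Measure.volume_eq_prod,
      setIntegral_prod]
    · refine setIntegral_congr_fun measurableSet_Ioi fun r _ => ?_
      simp only [hsym]
      rw [integral_smul, circleAverage_eq_integral_add (-π), smul_smul (2 * π),
        mul_inv_cancel₀ (by positivity), one_smul,
        intervalIntegral.integral_comp_add_right (fun θ => w (circleMap 0 r θ)),
        show 0 + -π = -π by ring, show 2 * π + -π = π by ring,
        intervalIntegral.integral_of_le (by linarith [pi_pos]), integral_Ioc_eq_integral_Ioo]
    · refine IntegrableOn.of_forall_sdiff_eq_zero (s := Set.Icc 0 s ×ˢ Set.Icc (-π) π) ?_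
        (measurableSet_Ioi.prod measurableSet_Ioo) ?_
      · rw [← Measure.volume_eq_prod]
        exact hc.continuousOn.integrableOn_compact (isCompact_Icc.prod isCompact_Icc)
      · rintro ⟨r, θ⟩ ⟨⟨hr, hθ⟩, hn⟩
        have hr' : (0 : ℝ) < r := hr
        have : s ≤ r := by
          by_contra hlt
          exact hn ⟨⟨hr'.le, (not_le.1 hlt).le⟩, Set.Ioo_subset_Icc_self hθ⟩
        simp only [hsym]
        rw [hw0 _ (by simpa [abs_of_pos hr'] using this), smul_zero]
  rw [key w hw hw0, key w' hw' hw'0]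
  refine setIntegral_congr_fun measurableSet_Ioi fun r hr => ?_
  simp only [h r hr]

/-- A smooth radial kernel reproducing all polyanalytic functions of a given order. -/
theorem exists_reproducing_kernel (q : ℕ) {s : ℝ} (hs : 0 < s) :
    ∃ φ : ℂ → ℂ, ContDiff ℝ ∞ φ ∧ HasCompactSupport φ ∧ tsupport φ ⊆ ball 0 s ∧
      ∀ c g, QAnalyticOn q g (ball c s) → ∫ t, φ t * g (c + t) = g c := by
  set ψ : ℂ → ℝ := fun t => Real.smoothTransition (1 - ‖t‖ ^ 2 / (s / 2) ^ 2) with hψ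
  have hψs : ContDiff ℝ ∞ ψ := by
    refine Real.smoothTransition.contDiff.comp (contDiff_const.sub ?_)
    exact (contDiff_norm_sq ℝ).div_const _
  have hψ0 : ∀ t, s / 2 ≤ ‖t‖ → ψ t = 0 := by
    intro t ht
    refine Real.smoothTransition.zero_of_nonpos ?_
    rw [sub_nonpos, one_le_div (by positivity)]
    gcongr
  have hcs : ∀ {F : ℂ → ℂ}, (∀ t, s / 2 < ‖t‖ → F t = 0) →
      tsupport F ⊆ closedBall 0 (s / 2) := by
    intro F hF
    refine closure_minimal (fun t ht => ?_) isClosed_closedBall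
    by_contra hn
    exact ht (hF t (by simpa using hn))
  have hψcs : HasCompactSupport ψ := by
    refine HasCompactSupport.intro (isCompact_closedBall 0 (s / 2)) fun t ht => ?_
    exact hψ0 t (le_of_lt (by simpa using ht))
  set C : ℝ := ∫ t, ψ t with hC
  have hC0 : 0 < C := by
    refine hψs.continuous.integral_pos_of_hasCompactSupport_nonneg_nonzero (x := 0) hψcs
      (fun t => Real.smoothTransition.nonneg _) ?_
    simp [hψ]
  set σ : Fin q → ℝ := fun k => ((k : ℝ) + 1)⁻¹ with hσ
  have hσ0 : ∀ k, 0 < σ k := fun k => by positivity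
  have hσ1 : ∀ k, σ k ≤ 1 := fun k => by
    refine inv_le_one_of_one_le₀ ?_
    have : (0 : ℝ) ≤ (k : ℕ) := by positivity
    linarith
  set v : Fin q → ℂ := fun k => (σ k : ℂ) ^ 2 with hv
  have hvi : Function.Injective v := by
    intro i j hij
    simp only [hv] at hij
    have h1 : σ i ^ 2 = σ j ^ 2 := by exact_mod_cast hij
    have h2 : σ i = σ j := (pow_left_inj₀ (hσ0 i).le (hσ0 j).le two_ne_zero).1 h1
    have h3 : (i : ℝ) = (j : ℕ) := by simpa [hσ] using h2
    exact Fin.ext (by exact_mod_cast h3)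
  set l : Fin q → ℂ := fun k => (Lagrange.basis Finset.univ v k).eval 0 with hl
  set φ : ℂ → ℂ := fun t => ∑ k, (l k * ((C : ℂ) * (σ k : ℂ) ^ 2)⁻¹) * (ψ ((σ k)⁻¹ • t) : ℂ) with hφ
  have hφs : ContDiff ℝ ∞ φ := by
    refine ContDiff.sum fun k _ => contDiff_const.mul ?_
    exact Complex.ofRealCLM.contDiff.comp (hψs.comp (contDiff_const_smul _))
  have hψ0' : ∀ k, ∀ t, s / 2 ≤ ‖t‖ → ψ ((σ k)⁻¹ • t) = 0 := by
    intro k t ht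
    refine hψ0 _ (ht.trans ?_)
    rw [norm_smul, norm_inv, Real.norm_of_nonneg (hσ0 k).le]
    exact le_mul_of_one_le_left (norm_nonneg _) ((one_le_inv₀ (hσ0 k)).2 (hσ1 k))
  have hφ0 : ∀ t, s / 2 ≤ ‖t‖ → φ t = 0 := by
    intro t ht
    refine Finset.sum_eq_zero fun k _ => ?_
    rw [hψ0' k t ht]
    simp
  have hφt : tsupport φ ⊆ ball 0 s :=
    (hcs fun t ht => hφ0 t ht.le).trans (closedBall_subset_ball (by linarith))
  have hφr : ∀ t t', ‖t‖ = ‖t'‖ → φ t = φ t' := by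
    intro t t' htt
    simp only [hφ, hψ, norm_smul, htt]
  refine ⟨φ, hφs, HasCompactSupport.intro (isCompact_closedBall 0 (s / 2)) fun t ht =>
    hφ0 t (le_of_lt (by simpa using ht)), hφt, fun c g hg => ?_⟩
  obtain ⟨P, hPd, hP0, hPc⟩ := hg.exists_circleAverage_eq hs
  have hPcont : ∀ x : ℝ, Continuous fun t : ℂ => P.eval ((x : ℂ) ^ 2 * (‖t‖ : ℂ) ^ 2) := by
    intro x
    exact P.continuous.comp (by fun_prop)
  have step1 : ∫ t, φ t * g (c + t) = ∫ t, φ t * P.eval ((‖t‖ : ℂ) ^ 2) := by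
    refine integral_eq_of_circleAverage_eq (s := s / 2) ?_ (fun t ht => by rw [hφ0 t ht, zero_mul])
      (hφs.continuous.mul (by simpa using hPcont 1)) (fun t ht => by rw [hφ0 t ht, zero_mul]) ?_
    · refine ContinuousOn.continuous_of_tsupport_subset (s := ball 0 s) ?_ isOpen_ball
        (tsupport_mul_subset_left.trans hφt)
      exact hφs.continuous.continuousOn.mul hg.translate_ball.continuousOn
    · intro r hr
      have hn : ∀ t ∈ sphere (0 : ℂ) |r|, ‖t‖ = r := fun t ht => by simpa [abs_of_pos hr] using ht
      have h2 : Real.circleAverage (fun t => φ t * P.eval ((‖t‖ : ℂ) ^ 2)) 0 r =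
          φ r * P.eval ((r : ℂ) ^ 2) := by
        refine Real.circleAverage_const_on_circle fun t ht => ?_
        rw [hn t ht, hφr t r (by rw [hn t ht, Complex.norm_real, Real.norm_of_nonneg hr.le])]
      have h1 : Real.circleAverage (fun t => φ t * g (c + t)) 0 r =
          φ r * Real.circleAverage (fun t => g (c + t)) 0 r := by
        rw [← smul_eq_mul, ← Real.circleAverage_fun_smul]
        refine Real.circleAverage_congr_sphere fun t ht => ?_
        simp only [smul_eq_mul]
        rw [hφr t r (by rw [hn t ht, Complex.norm_real, Real.norm_of_nonneg hr.le])]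
      rw [h1, h2]
      rcases lt_or_ge r s with hrs | hrs
      · rw [hPc r hr hrs]
      · rw [hφ0 r (by rw [Complex.norm_real, Real.norm_of_nonneg hr.le]; linarith), zero_mul,
          zero_mul]
  have hint : ∀ x : ℝ, Integrable fun t : ℂ => (ψ t : ℂ) * P.eval ((x : ℂ) ^ 2 * (‖t‖ : ℂ) ^ 2) := by
    intro x
    refine Continuous.integrable_of_hasCompactSupport ?_ ?_
    · exact (Complex.continuous_ofReal.comp hψs.continuous).mul (hPcont x)
    · refine HasCompactSupport.intro (isCompact_closedBall 0 (s / 2)) fun t ht => ?_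
      rw [hψ0 t (le_of_lt (by simpa using ht))]
      simp
  have hscale : ∀ k, (fun t : ℂ => (ψ ((σ k)⁻¹ • t) : ℂ) * P.eval ((‖t‖ : ℂ) ^ 2)) =
      fun t => (fun t : ℂ => (ψ t : ℂ) * P.eval ((σ k : ℂ) ^ 2 * (‖t‖ : ℂ) ^ 2)) ((σ k)⁻¹ • t) := by
    intro k
    ext t
    have h0 : (σ k : ℂ) ≠ 0 := by exact_mod_cast (hσ0 k).ne'
    beta_reduce
    rw [norm_smul, norm_inv, Real.norm_of_nonneg (hσ0 k).le]
    push_cast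
    rw [mul_pow, ← mul_assoc, ← mul_pow, mul_inv_cancel₀ h0, one_pow, one_mul]
  have step2 : ∫ t, φ t * P.eval ((‖t‖ : ℂ) ^ 2) =
      ∑ k, (l k * (C : ℂ)⁻¹) * ∫ t, (ψ t : ℂ) * P.eval ((σ k : ℂ) ^ 2 * (‖t‖ : ℂ) ^ 2) := by
    have : ∀ t : ℂ, φ t * P.eval ((‖t‖ : ℂ) ^ 2) = ∑ k, (l k * ((C : ℂ) * (σ k : ℂ) ^ 2)⁻¹) *
        ((ψ ((σ k)⁻¹ • t) : ℂ) * P.eval ((‖t‖ : ℂ) ^ 2)) := by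
      intro t
      rw [hφ, Finset.sum_mul]
      simp only [mul_assoc]
    simp only [this]
    rw [integral_finsetSum]
    · refine Finset.sum_congr rfl fun k _ => ?_
      have h0 : (σ k : ℂ) ≠ 0 := by exact_mod_cast (hσ0 k).ne'
      have hC0' : (C : ℂ) ≠ 0 := by exact_mod_cast hC0.ne'
      rw [integral_const_mul, hscale k, Measure.integral_comp_smul volume
        (fun t : ℂ => (ψ t : ℂ) * P.eval ((σ k : ℂ) ^ 2 * (‖t‖ : ℂ) ^ 2)), Complex.finrank_real_complex,
        abs_of_nonneg (by have := hσ0 k; positivity), Complex.real_smul]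
      push_cast
      field_simp
    · intro k _
      refine Integrable.const_mul ?_ _
      rw [hscale k]
      exact (hint (σ k)).comp_smul (inv_ne_zero (hσ0 k).ne')
  rw [step1, step2]
  have hC0' : (C : ℂ) ≠ 0 := by exact_mod_cast hC0.ne'
  have step3 : ∀ t : ℂ, ∑ k, (l k * (C : ℂ)⁻¹) * ((ψ t : ℂ) * P.eval ((σ k : ℂ) ^ 2 * (‖t‖ : ℂ) ^ 2)) =
      (ψ t : ℂ) * ((C : ℂ)⁻¹ * g c) := by
    intro t
    have hd : (P.comp (Polynomial.C ((‖t‖ : ℂ) ^ 2) * Polynomial.X)).degree < q := by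
      rw [Polynomial.degree_lt_iff_coeff_zero] at hPd ⊢
      intro m hm
      rw [Polynomial.comp_C_mul_X_coeff, hPd m hm, zero_mul]
    have := polynomial_eval_eq_sum_basis hvi hd 0
    simp only [Polynomial.eval_comp, Polynomial.eval_mul, Polynomial.eval_C, Polynomial.eval_X,
      mul_zero, hP0] at this
    rw [this, Finset.mul_sum, Finset.mul_sum]
    refine Finset.sum_congr rfl fun k _ => ?_
    simp only [hl, hv]
    rw [mul_comm ((‖t‖ : ℂ) ^ 2)]
    ring
  simp only [← integral_const_mul]
  rw [← integral_finsetSum _ fun k _ => (hint (σ k)).const_mul _]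
  simp only [step3]
  rw [integral_mul_const, integral_complex_ofReal, ← hC, ← mul_assoc, mul_inv_cancel₀ hC0', one_mul]

namespace SepQAnalyticOn

theorem finCons {n : ℕ} {α : Fin (n + 1) → ℕ} {f : (Fin (n + 1) → ℂ) → ℂ}
    {Ω : Set (Fin (n + 1) → ℂ)} (hf : SepQAnalyticOn α f Ω) (ζ : ℂ) :
    SepQAnalyticOn (Fin.tail α) (fun z : Fin n → ℂ => f (Fin.cons ζ z))
      {z | (Fin.cons ζ z : Fin (n + 1) → ℂ) ∈ Ω} := by
  intro j c
  have := hf j.succ (Fin.cons ζ c)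
  simp only [← Fin.cons_update] at this
  exact this

theorem finCons_left {n : ℕ} {α : Fin (n + 1) → ℕ} {f : (Fin (n + 1) → ℂ) → ℂ}
    {Ω : Set (Fin (n + 1) → ℂ)} (hf : SepQAnalyticOn α f Ω) (z : Fin n → ℂ) :
    QAnalyticOn (α 0) (fun ζ => f (Fin.cons ζ z)) {ζ | (Fin.cons ζ z : Fin (n + 1) → ℂ) ∈ Ω} := by
  have := hf 0 (Fin.cons 0 z)
  simp only [Fin.update_cons_zero] at this
  exact this

end SepQAnalyticOn

theorem integral_pi_eq_integral_finCons {n : ℕ} (G : (Fin (n + 1) → ℂ) → ℂ) :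
    ∫ t, G t = ∫ p : ℂ × (Fin n → ℂ), G (Fin.cons p.1 p.2) := by
  rw [← (volume_preserving_piFinSuccAbove (fun _ : Fin (n + 1) => ℂ) 0).symm.integral_comp']
  congr 1
  ext p
  simp [MeasurableEquiv.piFinSuccAbove, Fin.insertNthEquiv, Fin.insertNth_zero']

/-- Product kernel. -/
def prodKernel {n : ℕ} (φ : Fin n → ℂ → ℂ) (t : Fin n → ℂ) : ℂ := ∏ j, φ j (t j)

section

variable {n : ℕ} {φ : Fin n → ℂ → ℂ} {s : ℝ}

theorem tsupport_prodKernel_subset (φ : Fin n → ℂ → ℂ) :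
    tsupport (prodKernel φ) ⊆ Set.univ.pi fun j => tsupport (φ j) := by
  refine closure_minimal (fun t ht j _ => subset_closure ?_)
    (isClosed_set_pi fun j _ => isClosed_tsupport _)
  exact fun h => ht (Finset.prod_eq_zero (Finset.mem_univ j) h)

theorem hasCompactSupport_prodKernel (hφ : ∀ j, HasCompactSupport (φ j)) :
    HasCompactSupport (prodKernel φ) :=
  (isCompact_univ_pi hφ).of_isClosed_subset (isClosed_tsupport _) (tsupport_prodKernel_subset φ)

theorem tsupport_prodKernel_subset_ball (hs : 0 < s) (hφ : ∀ j, tsupport (φ j) ⊆ ball 0 s) :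
    tsupport (prodKernel φ) ⊆ ball 0 s := by
  refine (tsupport_prodKernel_subset φ).trans fun t ht => ?_
  rw [mem_ball, dist_pi_lt_iff hs]
  exact fun j => hφ j (ht j trivial)

theorem contDiff_prodKernel (hφ : ∀ j, ContDiff ℝ ∞ (φ j)) : ContDiff ℝ ∞ (prodKernel φ) :=
  contDiff_prod fun j _ => (hφ j).comp (contDiff_apply ℝ ℂ j)

end

theorem integral_prodKernel_mul (n : ℕ) : ∀ {α : Fin n → ℕ} {f : (Fin n → ℂ) → ℂ} {z : Fin n → ℂ}
    {s : ℝ} {φ : Fin n → ℂ → ℂ}, 0 < s → (∀ j, ContDiff ℝ ∞ (φ j)) →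
    (∀ j, HasCompactSupport (φ j)) → (∀ j, tsupport (φ j) ⊆ ball 0 s) →
    (∀ j c g, QAnalyticOn (α j) g (ball c s) → ∫ t, φ j t * g (c + t) = g c) →
    ContinuousOn f (ball z s) → SepQAnalyticOn α f (ball z s) →
    ∫ t, prodKernel φ t * f (z + t) = f z := by
  induction n with
  | zero =>
    intro α f z s φ _ _ _ _ _ _ _
    rw [volume_pi, Measure.pi_of_empty _ 0, integral_dirac]
    simp only [prodKernel, Finset.univ_eq_empty, Finset.prod_empty, one_mul]
    exact congrArg f (Subsingleton.elim _ _)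
  | succ n ih =>
    intro α f z s φ hs hφs hφc hφt hφr hf hsep
    have hcont : Continuous fun t => prodKernel φ t * f (z + t) := by
      refine ContinuousOn.continuous_of_tsupport_subset (s := ball 0 s) ?_ isOpen_ball
        (tsupport_mul_subset_left.trans (tsupport_prodKernel_subset_ball hs hφt))
      refine (contDiff_prodKernel hφs).continuous.continuousOn.mul ?_
      exact hf.comp (continuous_const.add continuous_id).continuousOn fun t ht => by
        simpa using ht
    have hcs : HasCompactSupport fun t => prodKernel φ t * f (z + t) :=
      (hasCompactSupport_prodKernel hφc).mul_right
    have hint : Integrable fun t => prodKernel φ t * f (z + t) :=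
      hcont.integrable_of_hasCompactSupport hcs
    have hint' : Integrable fun p : ℂ × (Fin n → ℂ) =>
        prodKernel φ (Fin.cons p.1 p.2) * f (z + Fin.cons p.1 p.2) := by
      have := ((volume_preserving_piFinSuccAbove (fun _ : Fin (n + 1) => ℂ) 0).symm.integrable_comp_emb
        (MeasurableEquiv.measurableEmbedding _) (g := fun t => prodKernel φ t * f (z + t))).2 hint
      refine this.congr (ae_of_all _ fun p => ?_)
      simp [MeasurableEquiv.piFinSuccAbove, Fin.insertNthEquiv, Fin.insertNth_zero']
    rw [integral_pi_eq_integral_finCons, Measure.volume_eq_prod, integral_prod _ hint']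
    have hcons : ∀ ζ : ℂ, ∀ t : Fin n → ℂ, z + Fin.cons ζ t =
        (Fin.cons (z 0 + ζ) (Fin.tail z + t) : Fin (n + 1) → ℂ) := by
      intro ζ t
      ext j
      refine Fin.cases ?_ (fun i => ?_) j <;> simp [Fin.tail]
    have hinner : ∀ ζ : ℂ, ∫ t : Fin n → ℂ, prodKernel φ (Fin.cons ζ t) * f (z + Fin.cons ζ t) =
        φ 0 ζ * f (Fin.cons (z 0 + ζ) (Fin.tail z)) := by
      intro ζ
      by_cases hζ : ζ ∈ ball (0 : ℂ) s
      · have hζ' : z 0 + ζ ∈ ball (z 0) s := by simpa using hζ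
        have hsub : ∀ t ∈ ball (Fin.tail z) s, (Fin.cons (z 0 + ζ) t : Fin (n + 1) → ℂ) ∈ ball z s :=
          fun t ht => (Fin.cons_mem_ball_iff hs).2 ⟨hζ', ht⟩
        have := ih (α := Fin.tail α) (f := fun t => f (Fin.cons (z 0 + ζ) t)) (z := Fin.tail z)
          (φ := Fin.tail φ) hs (fun j => hφs j.succ) (fun j => hφc j.succ) (fun j => hφt j.succ)
          (fun j => hφr j.succ) (hf.comp (continuous_finCons _).continuousOn hsub)
          ((hsep.finCons _).mono hsub)
        rw [← this, ← integral_const_mul]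
        congr 1
        ext t
        simp only [prodKernel, hcons, Fin.prod_univ_succ, Fin.cons_zero, Fin.cons_succ, Fin.tail]
        ring
      · have h0 : φ 0 ζ = 0 := by
          by_contra hn
          exact hζ (hφt 0 (subset_tsupport _ hn))
        rw [h0, zero_mul, ← integral_zero (Fin n → ℂ) ℂ]
        congr 1
        ext t
        simp [prodKernel, Fin.prod_univ_succ, h0]
    simp only [hinner]
    have := hφr 0 (z 0) (fun ζ => f (Fin.cons ζ (Fin.tail z)))
      ((hsep.finCons_left (Fin.tail z)).mono fun ζ hζ =>
        (Fin.cons_mem_ball_iff hs).2 ⟨hζ, mem_ball_self hs⟩)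
    rw [this, Fin.cons_self_tail]

/-- Continuous separately polyanalytic functions are smooth. -/
theorem SepQAnalyticOn.contDiffOn {n : ℕ} {α : Fin n → ℕ} {f : (Fin n → ℂ) → ℂ}
    {Ω : Set (Fin n → ℂ)} (hΩ : IsOpen Ω) (hf : SepQAnalyticOn α f Ω) (hc : ContinuousOn f Ω) :
    ContDiffOn ℝ ∞ f Ω := by
  intro p hp
  refine ContDiffAt.contDiffWithinAt ?_
  obtain ⟨δ, hδ, hδΩ⟩ := nhds_basis_closedBall.mem_iff.1 (hΩ.mem_nhds hp)
  have hs : 0 < δ / 2 := half_pos hδ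
  choose φ hφs hφc hφt hφr using fun j => exists_reproducing_kernel (α j) hs
  set g : (Fin n → ℂ) → ℂ := (closedBall p δ).indicator f with hg
  have hgi : Integrable g :=
    ((hc.mono hδΩ).integrableOn_compact (isCompact_closedBall p δ)).integrable_indicator
      measurableSet_closedBall
  set Φ : (Fin n → ℂ) → ℂ := fun t => prodKernel φ (-t) with hΦ
  have hΦs : ContDiff ℝ ∞ Φ := (contDiff_prodKernel hφs).comp contDiff_neg
  have hΦc : HasCompactSupport Φ :=
    (hasCompactSupport_prodKernel hφc).comp_homeomorph (Homeomorph.neg _)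
  have hconv := HasCompactSupport.contDiff_convolution_left (μ := volume)
    (ContinuousLinearMap.mul ℝ ℂ) hΦc hΦs hgi.locallyIntegrable
  refine (hconv.contDiffAt (x := p)).congr_of_eventuallyEq ?_
  filter_upwards [ball_mem_nhds p hs] with z hz
  have hsub : ball z (δ / 2) ⊆ closedBall p δ := by
    refine (ball_subset_ball' (ε₂ := δ) ?_).trans ball_subset_closedBall
    have := mem_ball.1 hz
    linarith
  have hrep := integral_prodKernel_mul n hs hφs hφc hφt hφr (hc.mono (hsub.trans hδΩ))
    (hf.mono (hsub.trans hδΩ))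
  rw [← hrep, convolution_def, ← integral_neg_eq_self (fun t =>
    ContinuousLinearMap.mul ℝ ℂ (Φ t) (g (z - t)))]
  congr 1
  ext t
  simp only [hΦ, neg_neg, sub_neg_eq_add, ContinuousLinearMap.mul_apply']
  by_cases ht : t ∈ ball (0 : Fin n → ℂ) (δ / 2)
  · rw [hg, Set.indicator_of_mem (hsub (by simpa using ht))]
  · have : prodKernel φ t = 0 := by
      by_contra hn
      exact ht (tsupport_prodKernel_subset_ball hs hφt (subset_tsupport _ hn))
    rw [this, zero_mul, zero_mul]

/-- One-variable Wirtinger derivative of a monomial `a * conj z ^ k` with `a` holomorphic. -/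
theorem exists_hasFDerivAt_mul_conj_pow {a : ℂ → ℂ} {U : Set ℂ} (hU : IsOpen U)
    (ha : DifferentiableOn ℂ a U) (k : ℕ) {ζ : ℂ} (hζ : ζ ∈ U) :
    ∃ D : ℂ →L[ℝ] ℂ, HasFDerivAt (fun z => a z * conj z ^ k) D ζ ∧
      (1 / 2 : ℂ) * (D 1 + Complex.I * D Complex.I) = a ζ * (k * conj ζ ^ (k - 1)) := by
  have h1 : HasFDerivAt a _ ζ :=
    ((ha.differentiableAt (hU.mem_nhds hζ)).hasFDerivAt).restrictScalars ℝ
  have h2 : HasFDerivAt (fun z : ℂ => conj z) (Complex.conjCLE : ℂ →L[ℝ] ℂ) ζ :=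
    Complex.conjCLE.hasFDerivAt
  refine ⟨_, h1.mul (h2.pow k), ?_⟩
  have h3 : fderiv ℂ a ζ Complex.I = Complex.I * fderiv ℂ a ζ 1 := by
    rw [← smul_eq_mul, ← map_smul, smul_eq_mul, mul_one]
  simp [h3]
  ring_nf
  simp
  ring

theorem wirtingerBar_update {n : ℕ} {f : (Fin n → ℂ) → ℂ} {j : Fin n} {c : Fin n → ℂ} {ζ : ℂ}
    {D : ℂ →L[ℝ] ℂ} (hf : DifferentiableAt ℝ f (Function.update c j ζ))
    (hD : HasFDerivAt (fun ζ => f (Function.update c j ζ)) D ζ) :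
    wirtingerBar n j f (Function.update c j ζ) = (1 / 2 : ℂ) * (D 1 + Complex.I * D Complex.I) := by
  have h := hf.hasFDerivAt.comp ζ (hasFDerivAt_update (𝕜 := ℝ) c (i := j) ζ)
  have h' := h.unique hD
  have : ∀ v : ℂ, fderiv ℝ f (Function.update c j ζ) (Pi.single j v) = D v := by
    intro v
    rw [← h']
    simp only [ContinuousLinearMap.comp_apply]
    congr 1
    ext i
    rcases eq_or_ne i j with rfl | hi
    · simp
    · simp [hi]
  rw [wirtingerBar, this, this]

theorem contDiffOn_wirtingerBar {n : ℕ} {f : (Fin n → ℂ) → ℂ} {Ω : Set (Fin n → ℂ)}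
    (hΩ : IsOpen Ω) (hf : ContDiffOn ℝ ∞ f Ω) (j : Fin n) :
    ContDiffOn ℝ ∞ (wirtingerBar n j f) Ω := by
  have h := hf.fderiv_of_isOpen hΩ (m := ∞) (by simp)
  exact contDiffOn_const.mul ((h.clm_apply contDiffOn_const).add
    (contDiffOn_const.mul (h.clm_apply contDiffOn_const)))

theorem iterate_wirtingerBar_eq_zero {n : ℕ} {Ω : Set (Fin n → ℂ)} (hΩ : IsOpen Ω) (j : Fin n)
    (q : ℕ) : ∀ f : (Fin n → ℂ) → ℂ, ContDiffOn ℝ ∞ f Ω →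
      (∀ c, QAnalyticOn q (fun ζ => f (Function.update c j ζ)) {ζ | Function.update c j ζ ∈ Ω}) →
      ∀ z ∈ Ω, ((wirtingerBar n j)^[q] f) z = 0 := by
  induction q with
  | zero =>
    intro f _ hf z hz
    obtain ⟨a, -, h⟩ := hf z
    have := h (z j) (by simpa using hz)
    simpa using this
  | succ q ih =>
    intro f hfs hf z hz
    rw [Function.iterate_succ_apply]
    refine ih _ (contDiffOn_wirtingerBar hΩ hfs j) (fun c => ?_) z hz
    obtain ⟨a, ha, h⟩ := hf c
    set U := {ζ | Function.update c j ζ ∈ Ω} with hU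
    have hUo : IsOpen U := hΩ.preimage (continuous_const.update j continuous_id)
    refine ⟨fun k ζ => a k.succ ζ * ((k : ℕ) + 1 : ℂ), fun k => (ha _).mul_const _, fun ζ hζ => ?_⟩
    choose D hD hDv using fun k => exists_hasFDerivAt_mul_conj_pow hUo (ha k) (k : ℕ) hζ
    have hsum : HasFDerivAt (fun ζ => f (Function.update c j ζ)) (∑ k, D k) ζ := by
      refine (HasFDerivAt.fun_sum fun k _ => hD k).congr_of_eventuallyEq ?_
      filter_upwards [hUo.mem_nhds hζ] with w hw using h w hw
    beta_reduce
    rw [wirtingerBar_update ((hfs.contDiffAt (hΩ.mem_nhds hζ)).differentiableAt (by simp)) hsum]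
    simp only [_root_.sum_apply]
    rw [Finset.mul_sum, ← Finset.sum_add_distrib, Finset.mul_sum, Fin.sum_univ_succ]
    simp only [hDv]
    simp [mul_assoc]

/-- Left Riemann sums of a continuous function converge to the integral. -/
theorem tendsto_riemannSum {h : ℝ → ℂ} (hh : Continuous h) {T : ℝ} (hT : 0 < T) :
    Tendsto (fun N : ℕ => ∑ i ∈ Finset.range (N + 1), ((T / (N + 1) : ℝ) : ℂ) * h (i * (T / (N + 1))))
      atTop (𝓝 (∫ x in (0 : ℝ)..T, h x)) := by
  have hu : UniformContinuousOn h (Set.Icc 0 T) :=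
    isCompact_Icc.uniformContinuousOn_of_continuous hh.continuousOn
  rw [Metric.tendsto_atTop]
  intro ε hε
  obtain ⟨δ, hδ, hu⟩ := Metric.uniformContinuousOn_iff.1 hu (ε / (2 * T)) (by positivity)
  obtain ⟨N₀, hN₀⟩ := exists_nat_gt (T / δ)
  refine ⟨N₀, fun N hN => ?_⟩
  set d : ℝ := T / (N + 1) with hd
  have hN1 : (0 : ℝ) < (N : ℝ) + 1 := by positivity
  have hd0 : 0 < d := by positivity
  have hdT : ((N : ℝ) + 1) * d = T := by rw [hd]; field_simp
  have hdδ : d < δ := by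
    rw [hd, div_lt_iff₀ hN1]
    have : (N₀ : ℝ) ≤ N := by exact_mod_cast hN
    rw [div_lt_iff₀ hδ] at hN₀
    nlinarith
  have hsplit : ∫ x in (0 : ℝ)..T, h x =
      ∑ i ∈ Finset.range (N + 1), ∫ x in (i * d)..((i + 1 : ℕ) * d), h x := by
    rw [intervalIntegral.sum_integral_adjacent_intervals (a := fun i : ℕ => (i : ℝ) * d)
      fun k _ => hh.intervalIntegrable _ _]
    push_cast
    rw [zero_mul, hdT]
  have hterm : ∀ i ∈ Finset.range (N + 1),
      ‖(d : ℂ) * h (i * d) - ∫ x in (i * d)..((i + 1 : ℕ) * d), h x‖ ≤ ε / (2 * T) * d := by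
    intro i hi
    have hi' : (i : ℝ) + 1 ≤ N + 1 := by exact_mod_cast Finset.mem_range.1 hi
    have e1 : ((i + 1 : ℕ) : ℝ) * d = i * d + d := by push_cast; ring
    have hle : (i : ℝ) * d + d ≤ T := by rw [← hdT]; nlinarith
    have e2 : (d : ℂ) * h (i * d) = ∫ _ in (i * d)..((i + 1 : ℕ) * d), h (i * d) := by
      rw [intervalIntegral.integral_const, e1, add_sub_cancel_left, Complex.real_smul]
    rw [e2, ← intervalIntegral.integral_sub (by simp) (hh.intervalIntegrable _ _)]
    refine (intervalIntegral.norm_integral_le_of_norm_le_const (C := ε / (2 * T)) ?_).trans_eq ?_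
    · intro x hx
      rw [e1, Set.uIoc_of_le (by linarith)] at hx
      rw [← dist_eq_norm]
      have h0 : (0 : ℝ) ≤ i * d := by positivity
      refine (hu _ ⟨h0, by linarith⟩ x ⟨by linarith [hx.1], by linarith [hx.2]⟩ ?_).le
      rw [Real.dist_eq, abs_sub_lt_iff]
      constructor <;> linarith [hx.1, hx.2]
    · rw [e1, add_sub_cancel_left, abs_of_pos hd0]
  rw [hsplit, dist_eq_norm, ← Finset.sum_sub_distrib]
  refine (norm_sum_le_of_le _ hterm).trans_lt ?_
  rw [Finset.sum_const, Finset.card_range, nsmul_eq_mul]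
  push_cast
  calc ((N : ℝ) + 1) * (ε / (2 * T) * d) = ε / (2 * T) * (((N : ℝ) + 1) * d) := by ring
    _ = ε / 2 := by rw [hdT]; field_simp
    _ < ε := by linarith

/-- Riemann sums for circle averages. -/
theorem tendsto_circleAverage_riemannSum {w : ℂ → ℂ} {r : ℝ} (hr : 0 < r)
    (hw : ContinuousOn w (sphere 0 r)) :
    Tendsto (fun N : ℕ => ∑ i ∈ Finset.range (N + 1), ((N : ℂ) + 1)⁻¹ *
      w (circleMap 0 r (i * (2 * Real.pi / (N + 1))))) atTop (𝓝 (Real.circleAverage w 0 r)) := by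
  have hc : Continuous fun θ => w (circleMap 0 r θ) :=
    hw.comp_continuous (continuous_circleMap 0 r) fun θ => circleMap_mem_sphere 0 hr.le θ
  have := (tendsto_riemannSum hc Real.two_pi_pos).const_smul ((2 * Real.pi)⁻¹)
  rw [← Real.circleAverage_def] at this
  refine this.congr fun N => ?_
  rw [Finset.smul_sum]
  refine Finset.sum_congr rfl fun i _ => ?_
  rw [Complex.real_smul, ← mul_assoc]
  congr 1
  have : (Real.pi : ℂ) ≠ 0 := by exact_mod_cast Real.pi_ne_zero
  have : (N : ℂ) + 1 ≠ 0 := by exact_mod_cast N.succ_ne_zero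
  push_cast
  field_simp

/-- A bounded polyanalytic function is Lipschitz on a smaller disc, with uniform constant. -/
theorem QAnalyticOn.exists_lipschitzOnWith (q : ℕ) {s : ℝ} (hs : 0 < s) (M : ℝ) :
    ∃ K : ℝ≥0, ∀ c g, QAnalyticOn q g (ball c s) → (∀ z ∈ ball c s, ‖g z‖ ≤ M) →
      LipschitzOnWith K g (ball c (s / 2)) := by
  obtain ⟨φ, hφs, hφc, hφt, hφr⟩ := exists_reproducing_kernel q (half_pos hs)
  obtain ⟨L, hL⟩ := hφs.lipschitzWith_of_hasCompactSupport hφc (by simp)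
  set V : ℝ := volume.real (ball (0 : ℂ) s) with hV
  refine ⟨(L * M.toNNReal * V.toNNReal), fun c g hg hM => ?_⟩
  refine LipschitzOnWith.of_dist_le_mul fun z hz w hw => ?_
  have hsub : ∀ z ∈ ball c (s / 2), ball z (s / 2) ⊆ ball c s := by
    intro z hz
    refine ball_subset_ball' ?_
    have := mem_ball.1 hz
    linarith
  have hrep : ∀ z ∈ ball c (s / 2), g z = ∫ u in ball c s, φ (u - z) * g u := by
    intro z hz
    rw [← hφr z g (hg.mono (hsub z hz)), ← integral_add_left_eq_self (fun t => φ t * g (z + t)) (-z),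
      ← integral_indicator measurableSet_ball]
    congr 1
    ext u
    have e : z + (-z + u) = u := by ring
    have e' : -z + u = u - z := by ring
    rw [e, e']
    by_cases hu : u ∈ ball c s
    · rw [Set.indicator_of_mem hu]
    · rw [Set.indicator_of_notMem hu]
      have : φ (u - z) = 0 := by
        by_contra hn
        refine hu (hsub z hz ?_)
        rw [mem_ball_iff_norm]
        simpa using hφt (subset_tsupport _ hn)
      rw [this, zero_mul]
  have hint : ∀ z, IntegrableOn (fun u => φ (u - z) * g u) (ball c s) := by
    intro z
    obtain ⟨B, hB⟩ := hφs.continuous.bounded_above_of_compact_support hφc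
    have : IsFiniteMeasure (volume.restrict (ball c s)) := ⟨by
      rw [Measure.restrict_apply_univ]
      exact measure_ball_lt_top⟩
    refine Integrable.of_bound ?_ (B * M) ?_
    · have : ContinuousOn (fun u => φ (u - z) * g u) (ball c s) :=
        (hφs.continuous.comp (continuous_sub_right z)).continuousOn.mul hg.continuousOn
      exact this.aestronglyMeasurable measurableSet_ball
    · refine (ae_restrict_iff' measurableSet_ball).2 (ae_of_all _ fun u hu => ?_)
      rw [norm_mul]
      exact mul_le_mul (hB _) (hM u hu) (norm_nonneg _) ((norm_nonneg _).trans (hB 0))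
  have hM0 : 0 ≤ M := (norm_nonneg _).trans (hM c (mem_ball_self hs))
  rw [hrep z hz, hrep w hw, dist_eq_norm, ← integral_sub (hint z) (hint w)]
  have hVc : volume.real (ball c s) = V := by
    simp only [hV, Measure.real, Measure.addHaar_ball_center]
  refine (norm_setIntegral_le_of_norm_le_const (C := L * dist z w * M) measure_ball_lt_top
    fun u hu => ?_).trans_eq ?_
  · rw [← sub_mul, norm_mul]
    refine mul_le_mul ?_ (hM u hu) (norm_nonneg _) (by positivity)
    rw [← dist_eq_norm]
    refine (hL.dist_le_mul _ _).trans_eq ?_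
    rw [dist_sub_left]
  · rw [hVc]
    push_cast
    rw [Real.coe_toNNReal _ hM0, Real.coe_toNNReal _ measureReal_nonneg]
    ring

theorem norm_circleAverage_le {w : ℂ → ℂ} {r C : ℝ} (hr : 0 < r)
    (hC : ∀ t ∈ sphere (0 : ℂ) r, ‖w t‖ ≤ C) : ‖Real.circleAverage w 0 r‖ ≤ C := by
  rw [Real.circleAverage_def, norm_smul, norm_inv, Real.norm_of_nonneg Real.two_pi_pos.le,
    inv_mul_le_iff₀ Real.two_pi_pos]
  refine (intervalIntegral.norm_integral_le_of_norm_le_const (C := C) fun θ _ =>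
    hC _ (circleMap_mem_sphere 0 hr.le θ)).trans_eq ?_
  rw [sub_zero, abs_of_pos Real.two_pi_pos, mul_comm]

/-- Circle averages depend continuously on parameters. -/
theorem continuousOn_circleAverage {X : Type*} [TopologicalSpace X] [FirstCountableTopology X]
    {s : Set X} {G : ℂ → X → ℂ} {r C : ℝ} (hr : 0 < r)
    (hG : ∀ z ∈ s, ContinuousOn (fun t => G t z) (sphere 0 r))
    (hC : ∀ t ∈ sphere (0 : ℂ) r, ∀ z ∈ s, ‖G t z‖ ≤ C)
    (hc : ∀ t ∈ sphere (0 : ℂ) r, ContinuousOn (G t) s) :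
    ContinuousOn (fun z => Real.circleAverage (fun t => G t z) 0 r) s := by
  have hmem : ∀ θ, circleMap 0 r θ ∈ sphere (0 : ℂ) r := fun θ => circleMap_mem_sphere 0 hr.le θ
  intro z hz
  simp only [Real.circleAverage_def]
  refine ContinuousWithinAt.const_smul ?_ _
  refine intervalIntegral.continuousWithinAt_of_dominated_interval (bound := fun _ => C) ?_ ?_
    (by simp) ?_
  · filter_upwards [self_mem_nhdsWithin] with x hx
    exact ((hG x hx).comp_continuous (continuous_circleMap 0 r) hmem).aestronglyMeasurable
  · filter_upwards [self_mem_nhdsWithin] with x hx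
    exact ae_of_all _ fun θ _ => hC _ (hmem θ) x hx
  · exact ae_of_all _ fun θ _ => hc _ (hmem θ) z hz

theorem exists_radialModel_bound {n q : ℕ} {α : Fin n → ℕ} {F : ℂ → (Fin n → ℂ) → ℂ}
    {z₀ : Fin n → ℂ} {R ρ₀ : ℝ} (hF : ∀ t ∈ ball (0 : ℂ) R, SepQAnalyticOn α (F t) (ball z₀ ρ₀))
    (hFc : ∀ t ∈ ball (0 : ℂ) R, ContinuousOn (F t) (ball z₀ ρ₀))
    {a : (Fin n → ℂ) → Fin (q + 1) → ℂ → ℂ}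
    (ha : ∀ z ∈ ball z₀ ρ₀, ∀ j, DifferentiableOn ℂ (a z j) (ball 0 R))
    (hs : ∀ z ∈ ball z₀ ρ₀, ∀ t ∈ ball 0 R, F t z = ∑ j, a z j t * conj t ^ (j : ℕ))
    {r M : ℝ} (hr : 0 < r) (hrR : r < R) (hM0 : 0 ≤ M)
    (hM : ∀ t ∈ sphere 0 r, ∀ z ∈ ball z₀ ρ₀, ‖F t z‖ ≤ M)
    {R' ρ₁ : ℝ} (hR'0 : 0 < R') (hR' : R' < R) (hρ₁ : ρ₁ < ρ₀) :
    ∃ C, ∀ z ∈ ball z₀ ρ₁, ∀ t ∈ ball 0 R', ‖radialModel (a z) ((r : ℂ) ^ 2) t‖ ≤ C := by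
  obtain ⟨R₁, h1, hR₁⟩ := exists_between hR'
  obtain ⟨R₂, h12, hR₂⟩ := exists_between hR₁
  have hR₁0 : 0 < R₁ := hR'0.trans h1
  have hR₂0 : 0 < R₂ := hR₁0.trans h12
  have hsph : sphere (0 : ℂ) r ⊆ ball 0 R :=
    sphere_subset_closedBall.trans (closedBall_subset_ball hrR)
  have hne : ∀ t ∈ sphere (0 : ℂ) r, t ≠ 0 := fun t ht => ne_of_mem_sphere ht hr.ne'
  set w : ℕ → ℂ → (Fin n → ℂ) → ℂ := fun m t z => (t ^ m)⁻¹ * (t ^ q * F t z) with hw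
  set H : (Fin n → ℂ) → ℂ → ℂ := fun z => radialModel (a z) ((r : ℂ) ^ 2) with hH
  set c : ℕ → (Fin n → ℂ) → ℂ := fun m z => Real.circleAverage (fun t => w m t z) 0 r with hc
  have hHd : ∀ z ∈ ball z₀ ρ₀, DifferentiableOn ℂ (H z) (ball 0 R) := fun z hz =>
    radialModel_differentiableOn (ha z hz) _
  have hwH : ∀ m, ∀ z ∈ ball z₀ ρ₀, ∀ t ∈ sphere (0 : ℂ) r, w m t z = (t ^ m)⁻¹ * H z t := by
    intro m z hz t ht
    have e : (r : ℂ) = (‖t‖ : ℂ) := by rw [mem_sphere_zero_iff_norm.1 ht]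
    simp only [hw, hH]
    rw [e, radialModel_sq_norm, hs z hz t (hsph ht)]
  have hcH : ∀ m, ∀ z ∈ ball z₀ ρ₀, c m z = (m.factorial : ℂ)⁻¹ * iteratedDeriv m (H z) 0 := by
    intro m z hz
    rw [← circleAverage_inv_pow_mul hr hrR (hHd z hz)]
    refine Real.circleAverage_congr_sphere fun t ht => ?_
    rw [abs_of_pos hr] at ht
    exact hwH m z hz t ht
  have hwn : ∀ m, ∀ t ∈ sphere (0 : ℂ) r, ∀ z ∈ ball z₀ ρ₀,
      ‖w m t z‖ ≤ (r⁻¹) ^ m * (r ^ q * M) := by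
    intro m t ht z hz
    simp only [hw, norm_mul, norm_inv, norm_pow, mem_sphere_zero_iff_norm.1 ht, inv_pow]
    gcongr
    exact hM t ht z hz
  have hwc : ∀ m, ∀ z ∈ ball z₀ ρ₀, ContinuousOn (fun t => w m t z) (sphere 0 r) := by
    intro m z hz
    refine ContinuousOn.congr (f := fun t => (t ^ m)⁻¹ * H z t) ?_ fun t ht => hwH m z hz t ht
    refine ContinuousOn.mul ?_ ((hHd z hz).continuousOn.mono hsph)
    exact (continuous_pow m).continuousOn.inv₀ fun t ht => pow_ne_zero _ (hne t ht)
  have hcont : ∀ m, ContinuousOn (c m) (ball z₀ ρ₀) := fun m =>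
    continuousOn_circleAverage hr (hwc m) (hwn m) fun t ht =>
      (continuousOn_const.mul (hFc t (hsph ht))).const_mul ((t ^ m)⁻¹)
  have hwS : ∀ m, ∀ t ∈ sphere (0 : ℂ) r, SepQAnalyticOn α (w m t) (ball z₀ ρ₀) :=
    fun m t ht => ((hF t (hsph ht)).const_mul (t ^ q)).const_mul (t ^ m)⁻¹
  have happrox : ∀ m, ∃ (g : ℕ → (Fin n → ℂ) → ℂ) (M : ℝ),
      (∀ N, SepQAnalyticOn α (g N) (ball z₀ ρ₀)) ∧ (∀ N, ∀ z ∈ ball z₀ ρ₀, ‖g N z‖ ≤ M) ∧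
      ∀ z ∈ ball z₀ ρ₀, Tendsto (fun N => g N z) atTop (𝓝 (c m z)) := by
    intro m
    refine ⟨fun N z => ∑ i ∈ Finset.range (N + 1), ((N : ℂ) + 1)⁻¹ *
      w m (circleMap 0 r (i * (2 * Real.pi / (N + 1)))) z, (r⁻¹) ^ m * (r ^ q * M), fun N => ?_,
      fun N z hz => ?_, fun z hz =>
      tendsto_circleAverage_riemannSum (w := fun t => w m t z) hr (hwc m z hz)⟩
    · refine SepQAnalyticOn.sum _ fun i _ => SepQAnalyticOn.const_mul ?_ (((N : ℂ) + 1)⁻¹)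
      exact hwS m _ (circleMap_mem_sphere 0 hr.le _)
    · refine (norm_sum_le_of_le _ fun i _ => ?_).trans_eq (b := ∑ i ∈ Finset.range (N + 1),
        ((N : ℝ) + 1)⁻¹ * ((r⁻¹) ^ m * (r ^ q * M))) ?_
      · have : ‖((N : ℂ) + 1)⁻¹‖ = ((N : ℝ) + 1)⁻¹ := by
          rw [norm_inv]; congr 1; exact_mod_cast Complex.norm_natCast (N + 1)
        rw [norm_mul, this]
        gcongr
        exact hwn m _ (circleMap_mem_sphere 0 hr.le _) z hz
      · rw [Finset.sum_const, Finset.card_range, nsmul_eq_mul]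
        push_cast
        field_simp
  set L : ℝ := max 1 (max r⁻¹ (r ^ q * M)) with hL
  have hL1 : 1 ≤ L := le_max_left _ _
  have hLc : ∀ m, ∀ z ∈ ball z₀ ρ₀, ‖c m z‖ ≤ L ^ (m + 1) := by
    intro m z hz
    refine (norm_circleAverage_le hr fun t ht => hwn m t ht z hz).trans ?_
    rw [pow_succ]
    have : r⁻¹ ≤ L := (le_max_left _ _).trans (le_max_right _ _)
    have : r ^ q * M ≤ L := (le_max_right _ _).trans (le_max_right _ _)
    gcongr
  have hpt : ∀ z ∈ ball z₀ ρ₀, ∃ C, ∀ m, ‖c m z‖ ≤ C * (R₂⁻¹) ^ m := by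
    intro z hz
    have hcl : closedBall (0 : ℂ) R₂ ⊆ ball 0 R := closedBall_subset_ball hR₂
    obtain ⟨C, hC⟩ := (isCompact_sphere (0 : ℂ) R₂).exists_bound_of_continuousOn
      ((hHd z hz).continuousOn.mono (sphere_subset_closedBall.trans hcl))
    refine ⟨C, fun m => ?_⟩
    have := Complex.norm_iteratedDeriv_le_of_forall_mem_sphere_norm_le m hR₂0
      ((hHd z hz).mono (closure_ball_subset_closedBall.trans hcl)).diffContOnCl hC
    have hm : (0 : ℝ) < m.factorial := by exact_mod_cast m.factorial_pos
    rw [hcH m z hz, norm_mul, norm_inv, Complex.norm_natCast, inv_mul_le_iff₀ hm]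
    refine this.trans_eq ?_
    rw [inv_pow]
    ring
  obtain ⟨C, hC⟩ := exists_uniform_growth_bound hcont happrox hL1 hLc (inv_pos.2 hR₂0) hpt hρ₁
    (inv_strictAnti₀ hR₁0 h12)
  refine ⟨∑' m, C * (R' / R₁) ^ m, fun z hz t ht => ?_⟩
  have hz' := ball_subset_ball hρ₁.le hz
  have hx : R' / R₁ < 1 := (div_lt_one hR₁0).2 h1
  have hsum : Summable fun m : ℕ => C * (R' / R₁) ^ m :=
    (summable_geometric_of_lt_one (by positivity) hx).mul_left C
  have htR : t ∈ ball (0 : ℂ) R := ball_subset_ball hR'.le ht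
  have hTay := Complex.hasSum_taylorSeries_on_ball (hHd z hz') htR
  change ‖H z t‖ ≤ _
  rw [← hTay.tsum_eq]
  refine tsum_of_norm_bounded hsum.hasSum fun m => ?_
  have : (m.factorial : ℂ)⁻¹ • (t - 0) ^ m • iteratedDeriv m (H z) 0 = c m z * t ^ m := by
    rw [hcH m z hz', sub_zero, smul_eq_mul, smul_eq_mul]
    ring
  rw [this, norm_mul, norm_pow]
  have h0 : 0 ≤ C * R₁⁻¹ ^ m := (norm_nonneg _).trans (hC m z hz)
  calc ‖c m z‖ * ‖t‖ ^ m ≤ (C * R₁⁻¹ ^ m) * R' ^ m := by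
        gcongr
        · exact hC m z hz
        · exact (mem_ball_zero_iff.1 ht).le
    _ = C * (R' / R₁) ^ m := by rw [div_pow, inv_pow]; ring

theorem exists_local_bound {n q : ℕ} {α : Fin n → ℕ} {F : ℂ → (Fin n → ℂ) → ℂ}
    {z₀ : Fin n → ℂ} {R ρ₀ : ℝ} (hF : ∀ t ∈ ball (0 : ℂ) R, SepQAnalyticOn α (F t) (ball z₀ ρ₀))
    (hFc : ∀ t ∈ ball (0 : ℂ) R, ContinuousOn (F t) (ball z₀ ρ₀))
    (hFq : ∀ z ∈ ball z₀ ρ₀, QAnalyticOn (q + 1) (fun t => F t z) (ball 0 R))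
    {ε M : ℝ} (hε : 0 < ε) (hεR : ε < R) (hM0 : 0 ≤ M)
    (hM : ∀ t ∈ ball 0 ε, ∀ z ∈ ball z₀ ρ₀, ‖F t z‖ ≤ M)
    {R' ρ₁ : ℝ} (hR'0 : 0 < R') (hR' : R' < R) (hρ₁ : ρ₁ < ρ₀) :
    ∃ C, ∀ t ∈ ball 0 R', ∀ z ∈ ball z₀ ρ₁, ‖F t z‖ ≤ C := by
  have hex : ∀ z, ∃ a : Fin (q + 1) → ℂ → ℂ, z ∈ ball z₀ ρ₀ →
      (∀ j, DifferentiableOn ℂ (a j) (ball 0 R)) ∧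
      ∀ t ∈ ball 0 R, F t z = ∑ j, a j t * conj t ^ (j : ℕ) := by
    intro z
    by_cases hz : z ∈ ball z₀ ρ₀
    · obtain ⟨a, ha⟩ := hFq z hz
      exact ⟨a, fun _ => ha⟩
    · exact ⟨0, fun h => absurd h hz⟩
  choose a ha using hex
  set r : Fin (q + 1) → ℝ := fun k => ε / ((k : ℕ) + 2) with hr
  have hr0 : ∀ k, 0 < r k := fun k => by simp only [hr]; positivity
  have hrε : ∀ k, r k < ε := fun k => by
    simp only [hr]
    rw [div_lt_iff₀ (by positivity)]
    have : (0 : ℝ) ≤ (k : ℕ) := by positivity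
    nlinarith
  have hbd := fun k => exists_radialModel_bound (r := r k) hF hFc (fun z hz => (ha z hz).1)
    (fun z hz => (ha z hz).2) (hr0 k) ((hrε k).trans hεR) hM0
    (fun t ht z hz => hM t (sphere_subset_closedBall.trans (closedBall_subset_ball (hrε k)) ht) z hz)
    hR'0 hR' hρ₁
  choose C hC using hbd
  set v : Fin (q + 1) → ℂ := fun k => (r k : ℂ) ^ 2 with hv
  have hvi : Function.Injective v := by
    intro k l hkl
    have h1 : r k ^ 2 = r l ^ 2 := by simp only [hv] at hkl; exact_mod_cast hkl
    have h2 : r k = r l := (pow_left_inj₀ (hr0 k).le (hr0 l).le two_ne_zero).1 h1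
    simp only [hr] at h2
    rw [div_eq_div_iff (by positivity) (by positivity)] at h2
    have h3 := mul_left_cancel₀ hε.ne' h2
    have h4 : ((k : ℕ) : ℝ) = (l : ℕ) := by linarith
    exact Fin.ext (by exact_mod_cast h4)
  have hbas : ∀ k, ∃ B, ∀ t ∈ closedBall (0 : ℂ) R',
      ‖(Lagrange.basis Finset.univ v k).eval ((‖t‖ : ℂ) ^ 2)‖ ≤ B := fun k =>
    (isCompact_closedBall (0 : ℂ) R').exists_bound_of_continuousOn
      ((Lagrange.basis Finset.univ v k).continuous.comp
        ((Complex.continuous_ofReal.comp continuous_norm).pow 2)).continuousOn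
  choose B hB using hbas
  refine ⟨max M ((ε ^ q)⁻¹ * ∑ k, C k * B k), fun t ht z hz => ?_⟩
  have hz' := ball_subset_ball hρ₁.le hz
  rcases lt_or_ge ‖t‖ ε with h | h
  · exact (hM t (mem_ball_zero_iff.2 h) z hz').trans (le_max_left _ _)
  refine le_trans ?_ (le_max_right _ _)
  have htR : t ∈ ball (0 : ℂ) R := ball_subset_ball hR'.le ht
  set P : Polynomial ℂ := ∑ j : Fin (q + 1), Polynomial.C (a z j t * t ^ (q - j)) *
    Polynomial.X ^ (j : ℕ) with hP
  have hPe : ∀ s, P.eval s = radialModel (a z) s t := by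
    intro s
    rw [hP, Polynomial.eval_finsetSum, radialModel]
    refine Finset.sum_congr rfl fun j _ => ?_
    simp only [Polynomial.eval_mul, Polynomial.eval_C, Polynomial.eval_pow, Polynomial.eval_X]
    ring
  have hPd : P.degree < (q + 1 : ℕ) := by
    refine lt_of_le_of_lt (Polynomial.degree_sum_le _ _) ?_
    refine (Finset.sup_lt_iff (WithBot.bot_lt_coe (q + 1))).2 fun j _ => ?_
    exact lt_of_le_of_lt (Polynomial.degree_C_mul_X_pow_le _ _) (Nat.cast_lt.2 j.2)
  have key := polynomial_eval_eq_sum_basis hvi hPd ((‖t‖ : ℂ) ^ 2)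
  simp only [hPe] at key
  rw [radialModel_sq_norm, ← (ha z hz').2 t htR] at key
  have hn : ‖t‖ ^ q * ‖F t z‖ ≤ ∑ k, C k * B k := by
    rw [← norm_pow, ← norm_mul, key]
    refine norm_sum_le_of_le _ fun k _ => ?_
    rw [norm_mul]
    have := hC k z hz t ht
    exact mul_le_mul this (hB k t (ball_subset_closedBall ht)) (norm_nonneg _)
      ((norm_nonneg _).trans this)
  rw [← div_eq_inv_mul, le_div_iff₀ (by positivity), mul_comm]
  refine le_trans ?_ hn
  gcongr

/-- Baire category step: a pointwise bounded family that is bounded in the other direction is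
uniformly bounded on some disc. -/
theorem exists_ball_uniform_bound {X : Type*} {F : ℂ → X → ℂ} {s : Set X} {ζ₀ : ℂ} {η : ℝ}
    (hη : 0 < η) (hc : ∀ x ∈ s, ContinuousOn (fun ζ => F ζ x) (closedBall ζ₀ η))
    (hb : ∀ ζ ∈ closedBall ζ₀ η, ∃ C, ∀ x ∈ s, ‖F ζ x‖ ≤ C) :
    ∃ b ∈ ball ζ₀ η, ∃ ε > 0, ∃ N : ℕ, ball b ε ⊆ ball ζ₀ η ∧
      ∀ ζ ∈ ball b ε, ∀ x ∈ s, ‖F ζ x‖ ≤ N := by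
  set K : Set ℂ := closedBall ζ₀ η with hK
  set E : ℕ → Set K := fun N => {ζ | ∀ x ∈ s, ‖F ζ x‖ ≤ N} with hE
  have hEc : ∀ N, IsClosed (E N) := by
    intro N
    simp only [hE, Set.ofPred_forall]
    refine isClosed_biInter fun x hx => isClosed_le ?_ continuous_const
    exact (continuousOn_iff_continuous_domRestrict.1 (hc x hx)).norm
  have hEu : ⋃ N, E N = Set.univ := by
    refine Set.eq_univ_of_forall fun ζ => Set.mem_iUnion.2 ?_
    obtain ⟨C, hC⟩ := hb ζ ζ.2
    obtain ⟨N, hN⟩ := exists_nat_ge C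
    exact ⟨N, fun x hx => (hC x hx).trans hN⟩
  have : CompleteSpace K := (isClosed_closedBall.isComplete).completeSpace_coe
  have hd := dense_iUnion_interior_of_closed hEc hEu
  obtain ⟨b, hbE, hbη⟩ := hd.exists_mem_open (isOpen_ball.preimage continuous_subtype_val :
    IsOpen ((↑) ⁻¹' ball ζ₀ η : Set K)) ⟨⟨ζ₀, mem_closedBall_self hη.le⟩, mem_ball_self hη⟩
  obtain ⟨N, hbN⟩ := Set.mem_iUnion.1 hbE
  obtain ⟨V, hV, hVE⟩ := isOpen_induced_iff.1 (isOpen_interior (s := E N))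
  have hbV : (b : ℂ) ∈ V ∩ ball ζ₀ η := ⟨by rw [← hVE] at hbN; exact hbN, hbη⟩
  obtain ⟨ε, hε, hsub⟩ := Metric.isOpen_iff.1 (hV.inter isOpen_ball) b hbV
  refine ⟨b, hbη, ε, hε, N, fun ζ hζ => (hsub hζ).2, fun ζ hζ => ?_⟩
  have h1 : (⟨ζ, ball_subset_closedBall (hsub hζ).2⟩ : K) ∈ interior (E N) := by
    rw [← hVE]
    exact (hsub hζ).1
  exact interior_subset h1

/-- Separately polyanalytic functions are continuous. -/
theorem SepQAnalyticOn.continuousOn (n : ℕ) : ∀ {α : Fin n → ℕ} {f : (Fin n → ℂ) → ℂ}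
    {Ω : Set (Fin n → ℂ)}, (∀ j, 0 < α j) → IsOpen Ω → SepQAnalyticOn α f Ω →
    ContinuousOn f Ω := by
  induction n with
  | zero => exact fun _ _ _ => (Set.subsingleton_of_subsingleton).continuousOn _
  | succ n ih =>
  intro α f Ω hα hΩ hf p hp
  refine ContinuousAt.continuousWithinAt ?_
  obtain ⟨δ, hδ, hδΩ⟩ := Metric.isOpen_iff.1 hΩ p hp
  set F : ℂ → (Fin n → ℂ) → ℂ := fun ζ z => f (Fin.cons ζ z) with hF
  have hfδ := hf.mono hδΩ
  have hFs : ∀ ζ ∈ ball (p 0) δ, SepQAnalyticOn (Fin.tail α) (F ζ) (ball (Fin.tail p) δ) :=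
    fun ζ hζ => (hfδ.finCons ζ).mono fun z hz => (Fin.cons_mem_ball_iff hδ).2 ⟨hζ, hz⟩
  have hFc : ∀ ζ ∈ ball (p 0) δ, ContinuousOn (F ζ) (ball (Fin.tail p) δ) := fun ζ hζ =>
    ih (fun j => hα j.succ) isOpen_ball (hFs ζ hζ)
  have hFq : ∀ z ∈ ball (Fin.tail p) δ, QAnalyticOn (α 0) (fun ζ => F ζ z) (ball (p 0) δ) :=
    fun z hz => (hfδ.finCons_left z).mono fun ζ hζ => (Fin.cons_mem_ball_iff hδ).2 ⟨hζ, hz⟩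
  have hcl : closedBall (p 0) (δ / 4) ⊆ ball (p 0) δ := closedBall_subset_ball (by linarith)
  have hcl' : closedBall (Fin.tail p) (δ / 2) ⊆ ball (Fin.tail p) δ :=
    closedBall_subset_ball (by linarith)
  obtain ⟨b, hb, ε₀, hε₀, N, -, hN⟩ := exists_ball_uniform_bound (F := F)
    (s := closedBall (Fin.tail p) (δ / 2)) (ζ₀ := p 0) (η := δ / 4) (by positivity)
    (fun z hz => (hFq z (hcl' hz)).continuousOn.mono hcl)
    (fun ζ hζ => (isCompact_closedBall _ _).exists_bound_of_continuousOn
      ((hFc ζ (hcl hζ)).mono hcl'))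
  obtain ⟨q, hq⟩ : ∃ q, α 0 = q + 1 := ⟨α 0 - 1, by have := hα 0; omega⟩
  rw [hq] at hFq
  have hbp : dist b (p 0) < δ / 4 := hb
  have hbR : ball b (3 * δ / 4) ⊆ ball (p 0) δ := ball_subset_ball' (by linarith)
  have hadd : ∀ {R : ℝ} {t : ℂ}, t ∈ ball (0 : ℂ) R → b + t ∈ ball b R := fun ht => by
    simpa using ht
  have hball : ball (Fin.tail p) (δ / 2) ⊆ ball (Fin.tail p) δ := ball_subset_ball (by linarith)
  obtain ⟨C, hC⟩ := exists_local_bound (F := fun t => F (b + t)) (q := q) (R := 3 * δ / 4)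
    (z₀ := Fin.tail p) (ρ₀ := δ / 2) (ε := min ε₀ (δ / 4)) (M := N) (R' := 3 * δ / 8) (ρ₁ := δ / 4)
    (fun t ht => (hFs _ (hbR (hadd ht))).mono hball)
    (fun t ht => (hFc _ (hbR (hadd ht))).mono hball)
    (fun z hz => ((hFq z (hball hz)).mono hbR).translate_ball)
    (by positivity) ((min_le_right _ _).trans_lt (by linarith)) (Nat.cast_nonneg N)
    (fun t ht z hz => hN _ (ball_subset_ball (min_le_left _ _) (hadd ht)) z
      (ball_subset_closedBall hz))
    (by positivity) (by linarith) (by linarith)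
  have hbd : ∀ ζ ∈ ball (p 0) (δ / 8), ∀ z ∈ ball (Fin.tail p) (δ / 4), ‖F ζ z‖ ≤ C := by
    intro ζ hζ z hz
    have hζb : ζ - b ∈ ball (0 : ℂ) (3 * δ / 8) := by
      rw [mem_ball_zero_iff, ← dist_eq_norm]
      have := mem_ball.1 hζ
      have := dist_triangle_right ζ b (p 0)
      linarith
    simpa using hC _ hζb z hz
  obtain ⟨K, hK⟩ := QAnalyticOn.exists_lipschitzOnWith (q + 1) (s := δ / 8) (by positivity) C
  have hball' : ball (Fin.tail p) (δ / 4) ⊆ ball (Fin.tail p) δ := ball_subset_ball (by linarith)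
  have hjoint : ContinuousOn (fun x : ℂ × (Fin n → ℂ) => F x.1 x.2)
      (ball (p 0) (δ / 8 / 2) ×ˢ ball (Fin.tail p) (δ / 4)) := by
    refine continuousOn_prod_of_continuousOn_lipschitzOnWith _ K (fun ζ hζ => ?_) fun z hz => ?_
    · exact (hFc ζ (ball_subset_ball (by linarith) hζ)).mono hball'
    · exact hK _ _ ((hFq z (hball' hz)).mono (ball_subset_ball (by linarith)))
        fun ζ hζ => hbd ζ hζ z hz
  have hat := hjoint.continuousAt (x := (p 0, Fin.tail p)) (prod_mem_nhds
    (ball_mem_nhds _ (by positivity)) (ball_mem_nhds _ (by positivity)))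
  have hmap : Continuous fun w : Fin (n + 1) → ℂ => (w 0, Fin.tail w) :=
    (continuous_apply 0).prodMk (continuous_pi fun i => continuous_apply i.succ)
  have := ContinuousAt.comp (f := fun w : Fin (n + 1) → ℂ => (w 0, Fin.tail w)) (x := p) hat
    hmap.continuousAt
  refine this.congr (Eventually.of_forall fun w => ?_)
  simp [hF]

end

/-- Hartogs' theorem for polyanalytic functions: separately polyanalytic implies jointly
smooth and polyanalytic. -/
theorem separately_polyanalytic_implies_polyanalytic
    (n : ℕ) (Ω : Set (Fin n → ℂ)) (hopen : IsOpen Ω) (hconn : IsConnected Ω)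
    (α : Fin n → ℕ) (hα : ∀ j, 0 < α j)
    (f : (Fin n → ℂ) → ℂ)
    (hsep : ∀ (j : Fin n) (c : Fin n → ℂ),
      QAnalyticOn (α j) (fun ζ => f (Function.update c j ζ))
        {ζ : ℂ | Function.update c j ζ ∈ Ω}) :
    ContDiffOn ℝ (⊤ : ℕ∞) f Ω ∧ PolyanalyticOn n α f Ω := by
  have hc := SepQAnalyticOn.continuousOn n hα hopen hsep
  have hs := SepQAnalyticOn.contDiffOn hopen hsep hc
  exact ⟨hs, hs, fun j => iterate_wirtingerBar_eq_zero hopen j (α j) f hs (hsep j)⟩
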